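/- Let F be an algebraic closure of 𝔽_q, let c = (c₁, c₂) : C → X × X be a correspondence over F, and let X⁰ ⊆ X be a non-empty open subset, such that X and C are irreducible, c₂ is dominant, dim C = dim X, and both X and X⁰ are defined over 𝔽_q. Then there exist a non-empty open subset V ⊆ X⁰ and a proper morphism π : X̃ → X which restricts to an isomorphism π⁻¹(V) ≅ V, such that both V and π are defined over 𝔽_q, and for every correspondence c̃ : C̃ → X̃ × X̃ lifting c along π, the closed subset X̃ ∖ π⁻¹(V) ⊆ X̃ is locally c̃-invariant over 𝔽_q. -/

import Mathlib

/-!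
Corollary 2.4 of Varshavsky, "Intersection of a correspondence with a graph of Frobenius":
the main technical result (Proposition 2.3) over `𝔽_q`.
-/

open AlgebraicGeometry CategoryTheory CategoryTheory.Limits TopologicalSpace Opposite

universe u

/-- The morphism `Spec F ⟶ Spec 𝔽_q` induced by the algebra structure. -/
noncomputable abbrev specOfAlgebra (Fq F : Type u) [Field Fq] [Field F] [Algebra Fq F] :
    Spec (CommRingCat.of F) ⟶ Spec (CommRingCat.of Fq) :=
  Spec.map (CommRingCat.ofHom (algebraMap Fq F))

/-- The base change along `g : T ⟶ S` of a morphism `π₀ : Xt₀ ⟶ X₀` of schemes over `S`: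
the induced morphism `Xt₀ ×_S T ⟶ X₀ ×_S T`.  This expresses that a morphism between the
base-changed schemes is "defined over the base". -/
noncomputable def baseChangeHom {Xt₀ X₀ S T : Scheme.{u}} (sX₀ : X₀ ⟶ S) (g : T ⟶ S)
    (π₀ : Xt₀ ⟶ X₀) : pullback (π₀ ≫ sX₀) g ⟶ pullback sX₀ g :=
  pullback.map (π₀ ≫ sX₀) g sX₀ g π₀ (𝟙 T) (𝟙 S) (by simp) (by simp)

/-- `Z ∩ U ⊆ U` is `c|_U`-invariant, where `c|_U : c₁⁻¹(U) ∩ c₂⁻¹(U) → U × U` denotes the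
restriction of the correspondence `c = (c₁, c₂)` to an open subset `U ⊆ X`. -/
def CorrRestrictInvariant {C X : Scheme.{u}} (c₁ c₂ : C ⟶ X) (Z U : Set X) : Prop :=
  c₁.base '' ((c₁.base ⁻¹' U ∩ c₂.base ⁻¹' U) ∩ c₂.base ⁻¹' (Z ∩ U)) ⊆ Z ∩ U

/-- `Z` is locally `c`-invariant **over `𝔽_q`**: every point of `Z` has an open neighbourhood
`U ⊆ X` *defined over `𝔽_q`* (i.e. the preimage under the projection `pr : X ⟶ X₀` to the
`𝔽_q`-model of an open subset of `X₀`) such that `Z ∩ U ⊆ U` is `c|_U`-invariant. -/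
def CorrLocallyInvariantOver {C X X₀ : Scheme.{u}} (pr : X ⟶ X₀)
    (c₁ c₂ : C ⟶ X) (Z : Set X) : Prop :=
  ∀ x ∈ Z, ∃ U₀ : Set X₀, IsOpen U₀ ∧ x ∈ pr.base ⁻¹' U₀ ∧
    CorrRestrictInvariant c₁ c₂ Z (pr.base ⁻¹' U₀)

set_option linter.style.haveILetI false

noncomputable def trd {k K : Type u} [CommRing k] [CommRing K] (φ : k →+* K) : Cardinal.{u} :=
  letI := φ.toAlgebra
  Algebra.trdeg k K

def HFrac {A K : Type u} [CommRing A] [Field K] (f : A →+* K) : Prop :=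
  ∀ z, ∃ a b, f b ≠ 0 ∧ z * f b = f a

lemma trd_comp {k K L : Type u} [Field k] [Field K] [Field L] (φ : k →+* K) (ψ : K →+* L) :
    trd (ψ.comp φ) = trd φ + trd ψ := by
  letI := φ.toAlgebra
  letI := ψ.toAlgebra
  letI := (ψ.comp φ).toAlgebra
  haveI : IsScalarTower k K L := IsScalarTower.of_algebraMap_eq (fun _ => rfl)
  exact (_root_.trdeg_add_eq k K).symm

lemma trd_eq_zero_iff {k K : Type u} [Field k] [Field K] (φ : k →+* K) :
    trd φ = 0 ↔ φ.IsIntegral := by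
  letI := φ.toAlgebra
  have : trd φ = Algebra.trdeg k K := rfl
  rw [this, _root_.trdeg_eq_zero_iff, Algebra.isAlgebraic_iff_isIntegral]
  exact Algebra.isIntegral_def

lemma HFrac.isAlgebraic {k A K : Type u} [Field k] [CommRing A] [Field K] [Algebra k A]
    [Algebra k K] (f : A →ₐ[k] K) (hf : HFrac (f : A →+* K)) (s : Set K)
    (hs : Algebra.adjoin k s = f.range) : Algebra.IsAlgebraic (Algebra.adjoin k s) K := by
  refine ⟨fun z => ?_⟩
  obtain ⟨a, b, hb, hab⟩ := hf z
  have ha' : f a ∈ Algebra.adjoin k s := hs ▸ ⟨a, rfl⟩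
  have hb' : f b ∈ Algebra.adjoin k s := hs ▸ ⟨b, rfl⟩
  refine ⟨Polynomial.C ⟨f b, hb'⟩ * Polynomial.X - Polynomial.C ⟨f a, ha'⟩, ?_, ?_⟩
  · intro h
    have := congrArg (fun p => p.coeff 1) h
    simp at this
    exact hb (congrArg Subtype.val this)
  · simp only [map_sub, map_mul, Polynomial.aeval_C, Polynomial.aeval_X]
    change f b * z - f a = 0
    rw [mul_comm, sub_eq_zero]
    exact hab

lemma trd_fin {k A K : Type u} [Field k] [CommRing A] [Field K] (g : k →+* A)
    (hg : g.FiniteType) (f : A →+* K) (hf : HFrac f) : trd (f.comp g) < Cardinal.aleph0 := by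
  letI := g.toAlgebra
  letI := (f.comp g).toAlgebra
  let f' : A →ₐ[k] K := ⟨f, fun _ => rfl⟩
  haveI : Algebra.FiniteType k A := hg
  obtain ⟨s, hs⟩ := ‹Algebra.FiniteType k A›.out
  classical
  have h1 : Algebra.adjoin k (Set.image f' s) = f'.range := by
    rw [← AlgHom.map_adjoin, hs, Algebra.map_top]
  haveI := HFrac.isAlgebraic f' hf _ h1
  refine lt_of_le_of_lt (Algebra.IsAlgebraic.trdeg_le_cardinalMk k (Set.image f' (s : Set A))) ?_
  exact (s.finite_toSet.image f').lt_aleph0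

lemma trd_lt {k A K K' : Type u} [Field k] [CommRing A] [Field K] [Field K'] (g : k →+* A)
    (f : A →+* K) (f' : A →+* K') (hf' : HFrac f') (hle : ∀ a, f a = 0 → f' a = 0)
    (h : A) (hh' : f' h = 0) (hh : f h ≠ 0) (hfin : trd (f.comp g) < Cardinal.aleph0) :
    trd (f'.comp g) < trd (f.comp g) := by
  letI := g.toAlgebra
  letI := (f.comp g).toAlgebra
  letI := (f'.comp g).toAlgebra
  let F : A →ₐ[k] K := ⟨f, fun _ => rfl⟩
  let F' : A →ₐ[k] K' := ⟨f', fun _ => rfl⟩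
  haveI := HFrac.isAlgebraic F' hf' (Set.range F') (by
    rw [← AlgHom.coe_range, Algebra.adjoin_eq])
  obtain ⟨B, hB, hBt⟩ := exists_isTranscendenceBasis_subset (R := k) (Set.range F')
  choose u hu using fun b : B => hB b.2
  have key : ∀ p : MvPolynomial B k, F (MvPolynomial.aeval u p) +
      0 = 0 → p = 0 := by
    intro p hp
    rw [add_zero] at hp
    have h2 : F' (MvPolynomial.aeval u p) = 0 := hle _ hp
    rw [MvPolynomial.comp_aeval_apply] at h2
    have : (fun i => F' (u i)) = ((↑) : B → K') := funext hu
    rw [this] at h2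
    exact (algebraicIndependent_iff.1 hBt.1) p h2
  have key' : ∀ (p : MvPolynomial B k) (w : A), F (MvPolynomial.aeval u p) + F h * F w = 0 →
      p = 0 := by
    intro p w hp
    rw [← map_mul, ← map_add] at hp
    have h2 : F' (MvPolynomial.aeval u p + h * w) = 0 := hle _ hp
    rw [map_add, map_mul, show F' h = 0 from hh', zero_mul, add_zero,
      MvPolynomial.comp_aeval_apply] at h2
    have : (fun i => F' (u i)) = ((↑) : B → K') := funext hu
    rw [this] at h2
    exact (algebraicIndependent_iff.1 hBt.1) p h2
  have hx : AlgebraicIndependent k (fun b => F (u b)) := by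
    rw [algebraicIndependent_iff]
    intro p hp
    rw [← MvPolynomial.comp_aeval_apply] at hp
    exact key p (by rw [hp, add_zero])
  have hopt : AlgebraicIndependent k (fun o : Option B => o.elim (F h) (fun b => F (u b))) := by
    rw [hx.option_iff_transcendental]
    intro halg
    obtain ⟨Q, hQ0, hQ⟩ := halg.exists_nonzero_coeff_and_aeval_eq_zero
      (mem_nonZeroDivisors_of_ne_zero hh)
    have hc : ((Q.coeff 0 : Algebra.adjoin k (Set.range fun b => F (u b))) : K) ∈
        Algebra.adjoin k (Set.range fun b => F (u b)) := (Q.coeff 0).2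
    obtain ⟨p, hp⟩ := (SetLike.ext_iff.1 (Algebra.adjoin_range_eq_range_aeval k
      (fun b => F (u b))) _).1 hc
    have hw : ∀ R : Polynomial (Algebra.adjoin k (Set.range fun b => F (u b))),
        Polynomial.aeval (F h) R ∈ F.range := by
      intro R
      induction R using Polynomial.induction_on' with
      | add p q hp hq => rw [map_add]; exact add_mem hp hq
      | monomial n c =>
        rw [Polynomial.aeval_monomial]
        refine mul_mem ?_ (pow_mem (show F h ∈ F.range from ⟨h, rfl⟩) _)
        have : Algebra.adjoin k (Set.range fun b => F (u b)) ≤ F.range :=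
          Algebra.adjoin_le (by rintro _ ⟨b, rfl⟩; exact ⟨u b, rfl⟩)
        exact this c.2
    obtain ⟨w, hw⟩ := hw Q.divX
    rw [← Polynomial.divX_mul_X_add Q, map_add, map_mul, Polynomial.aeval_X,
      Polynomial.aeval_C] at hQ
    have h3 : p = 0 := by
      apply key' p w
      rw [MvPolynomial.comp_aeval_apply]
      have hw' : F w = Polynomial.aeval (F h) Q.divX := hw
      have hp' : MvPolynomial.aeval (fun i => F (u i)) p = (Q.coeff 0 : K) := hp
      rw [hw', hp', mul_comm, add_comm]
      exact hQ
    apply hQ0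
    apply Subtype.ext
    rw [← hp, h3]
    simp
  have h1 := hopt.cardinalMk_le_trdeg
  have h2 := hBt.cardinalMk_eq_trdeg
  change Algebra.trdeg k K' < Algebra.trdeg k K
  change Algebra.trdeg k K < _ at hfin
  rw [Cardinal.mk_option] at h1
  rw [← h2]
  have h4 : Cardinal.mk B < Cardinal.aleph0 := lt_of_le_of_lt (le_self_add.trans h1) hfin
  refine lt_of_lt_of_le ?_ h1
  obtain ⟨n, hn⟩ := Cardinal.lt_aleph0.1 h4
  rw [hn]
  exact_mod_cast Nat.lt_succ_self n

lemma alg_poly {A B L M : Type u} [CommRing A] [CommRing B] [Field L] [Field M]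
    (f : A →+* L) (hf : HFrac f) (φ : A →+* B) (g : B →+* M) (ι : L →+* M)
    (hcomm : ι.comp f = g.comp φ) (hι : ι.IsIntegral) (t : B) :
    ∃ q : Polynomial A, f q.leadingCoeff ≠ 0 ∧ g (q.eval₂ φ t) = 0 := by
  letI := ι.toAlgebra
  letI : Algebra f.range M := (ι.comp f.range.subtype).toAlgebra
  haveI : IsScalarTower f.range L M := IsScalarTower.of_algebraMap_eq (fun _ => rfl)
  haveI : Algebra.IsAlgebraic f.range L := by
    refine ⟨fun z => ?_⟩
    obtain ⟨a, b, hb, hab⟩ := hf z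
    refine ⟨Polynomial.C ⟨f b, ⟨b, rfl⟩⟩ * Polynomial.X - Polynomial.C ⟨f a, ⟨a, rfl⟩⟩, ?_, ?_⟩
    · intro h
      have := congrArg (fun p => p.coeff 1) h
      simp at this
      exact hb (congrArg Subtype.val this)
    · simp only [map_sub, map_mul, Polynomial.aeval_C, Polynomial.aeval_X]
      change f b * z - f a = 0
      rw [mul_comm, sub_eq_zero]
      exact hab
  have h1 : IsAlgebraic L (g t) := by
    have := hι (g t)
    exact IsIntegral.isAlgebraic this
  have h2 : IsAlgebraic f.range (g t) := h1.restrictScalars f.range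
  obtain ⟨p, hp0, hp⟩ := h2
  have hl : p ∈ Polynomial.lifts f.rangeRestrict :=
    (Polynomial.mem_lifts p).2 (Polynomial.map_surjective _ f.rangeRestrict_surjective p)
  obtain ⟨q, hq, hqd⟩ := Polynomial.exists_degree_eq_of_mem_lifts hl
  refine ⟨q, ?_, ?_⟩
  · intro h0
    have h5 : (Polynomial.map f.rangeRestrict q).coeff q.natDegree = 0 := by
      rw [Polynomial.coeff_map]
      exact Subtype.ext h0
    rw [hq, Polynomial.natDegree_eq_of_degree_eq hqd] at h5
    exact hp0 (Polynomial.leadingCoeff_eq_zero.1 h5)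
  · rw [Polynomial.hom_eval₂, ← hcomm]
    rw [← hq, Polynomial.aeval_def, Polynomial.eval₂_map] at hp
    exact hp

lemma isIntegral_of_gen {F B L M : Type u} [Field F] [CommRing B] [Field L] [Field M]
    (γ : F →+* B) (s : Set B) (hs : letI := γ.toAlgebra; Algebra.adjoin F s = ⊤)
    (g : B →+* M) (hg : HFrac g) (ι : L →+* M)
    (hF : ∀ x, ι.IsIntegralElem (g (γ x))) (hsi : ∀ x ∈ s, ι.IsIntegralElem (g x)) :
    ι.IsIntegral := by
  letI := γ.toAlgebra
  letI := ι.toAlgebra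
  have h1 : ∀ b : B, IsIntegral L (g b) := by
    intro b
    have hb : b ∈ Algebra.adjoin F s := by rw [hs]; trivial
    induction hb using Algebra.adjoin_induction with
    | mem x hx => exact hsi x hx
    | algebraMap r => exact hF r
    | add x y _ _ hx hy => rw [map_add]; exact hx.add hy
    | mul x y _ _ hx hy => rw [map_mul]; exact hx.mul hy
  intro z
  obtain ⟨a, b, hb, hab⟩ := hg z
  have : z = g a * (g b)⁻¹ := by rw [← hab]; field_simp
  change IsIntegral L z
  rw [this]
  exact (h1 a).mul (h1 b).inv

lemma exists_finite_generic {C : Type*} [TopologicalSpace C] [NoetherianSpace C] [QuasiSober C]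
    (K : Set C) (hK : IsClosed K) :
    ∃ s : Set C, s.Finite ∧ s ⊆ K ∧ ∀ y ∈ K, ∃ t ∈ s, t ⤳ y := by
  rcases isEmpty_or_nonempty C with hC | hC
  · exact ⟨∅, Set.finite_empty, Set.empty_subset _, fun y => (hC.false y).elim⟩
  obtain ⟨S, hS, hirr, hU⟩ := NoetherianSpace.exists_finite_set_isClosed_irreducible hK
  choose! g hg using fun (Z : Set C) (h : IsClosed Z ∧ IsIrreducible Z) =>
    QuasiSober.sober h.2 h.1
  refine ⟨g '' S, hS.image g, ?_, ?_⟩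
  · rintro _ ⟨Z, hZ, rfl⟩
    rw [hU.2]
    exact ⟨Z, hZ, (hg Z ⟨hirr Z hZ, hU.1 Z hZ⟩).mem⟩
  · intro y hy
    rw [hU.2] at hy
    obtain ⟨Z, hZ, hyZ⟩ := hy
    exact ⟨g Z, ⟨Z, hZ, rfl⟩, (hg Z ⟨hirr Z hZ, hU.1 Z hZ⟩).specializes hyZ⟩

/-- `Z` is good for the finite set of pairs `P`. -/
def SepBy {X C : Type*} [TopologicalSpace X] (a b : C → X) (Z : Set X) (P : Set (X × X))
    (D : Set X) : Prop :=
  ∀ y, b y ∈ Z → a y ∉ Z →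
    (∃ p ∈ P, p.1 ⤳ a y ∧ p.2 ⤳ b y ∧ ¬ p.1 ⤳ b y) ∨ b y ∈ D

lemma topo_induction {X C : Type*} [TopologicalSpace X] [T0Space X] [TopologicalSpace C]
    [NoetherianSpace C] [QuasiSober C] (a b : C → X) (ha : Continuous a) (hb : Continuous b)
    (δX : X → ℕ) (δC : C → ℕ) (h1 : ∀ y, δX (a y) ≤ δC y)
    (N : Set X) (hN : IsClosed N) (h2 : ∀ y, b y ∉ N → δC y ≤ δX (b y))
    (h3 : ∀ x x', x ⤳ x' → ¬ x' ⤳ x → δX x' < δX x) (n : ℕ) (η : X) (hη : δX η = n)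
    (d : ℕ) : ∀ (Z D : Set X) (P : Set (X × X)), IsClosed Z → IsClosed D → D ⊆ Z →
      P.Finite → η ∉ Z → d ≤ n → (∀ x ∈ D, δX x < d) →
      (∀ y, b y ∈ N → a y ∈ Z) → (∀ p ∈ P, p.2 ∈ Z) → SepBy a b Z P D →
      ∃ (Z' : Set X) (P' : Set (X × X)), IsClosed Z' ∧ Z ⊆ Z' ∧ η ∉ Z' ∧ P'.Finite ∧
        (∀ p ∈ P', p.2 ∈ Z') ∧ SepBy a b Z' P' ∅ := by
  induction d with
  | zero =>
    intro Z D P hZ hD hDZ hP hηZ hd hDd hNZ hPZ hsep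
    refine ⟨Z, P, hZ, subset_rfl, hηZ, hP, hPZ, ?_⟩
    intro y h h'
    rcases hsep y h h' with h | h
    · exact Or.inl h
    · exact absurd (hDd _ h) (by omega)
  | succ d ih =>
    intro Z D P hZ hD hDZ hP hηZ hd hDd hNZ hPZ hsep
    obtain ⟨s, hs, hsD, hsgen⟩ := exists_finite_generic (b ⁻¹' D) (hD.preimage hb)
    let s' : Set C := {t ∈ s | a t ∉ Z ∧ b t ∉ N}
    have hs' : s'.Finite := hs.subset (fun t ht => ht.1)
    let G : Set X := ⋃ t ∈ s', closure {a t} ∩ closure {b t}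
    have hG : IsClosed G := hs'.isClosed_biUnion fun t _ => isClosed_closure.inter isClosed_closure
    have hGd : ∀ x ∈ G, δX x < d := by
      intro x hx
      simp only [G, Set.mem_iUnion] at hx
      obtain ⟨t, ht, hx1, hx2⟩ := hx
      have hbD : b t ∈ D := hsD ht.1
      have hxZ : x ∈ Z := hDZ (hD.closure_subset_iff.2 (Set.singleton_subset_iff.2 hbD) hx2)
      have hsp : a t ⤳ x := specializes_iff_mem_closure.2 hx1
      have hnsp : ¬ x ⤳ a t := fun h => ht.2.1 (h.mem_closed hZ hxZ)
      have := h3 _ _ hsp hnsp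
      have := h1 t
      have := h2 t ht.2.2
      have := hDd _ hbD
      omega
    obtain ⟨r, hr, hrG, hrgen⟩ := exists_finite_generic (b ⁻¹' G) (hG.preimage hb)
    let r' : Set C := {t ∈ r | b t ∉ N}
    have hr' : r'.Finite := hr.subset (fun t ht => ht.1)
    let D' : Set X := ⋃ t ∈ r', closure {a t}
    have hD' : IsClosed D' := hr'.isClosed_biUnion fun t _ => isClosed_closure
    have hD'd : ∀ x ∈ D', δX x < d := by
      intro x hx
      simp only [D', Set.mem_iUnion] at hx
      obtain ⟨t, ht, hx⟩ := hx
      have hsp : a t ⤳ x := specializes_iff_mem_closure.2 hx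
      have h4 : δX x ≤ δX (a t) := by
        by_cases h : x ⤳ a t
        · exact le_of_eq (congrArg δX (h.antisymm hsp).eq)
        · exact (h3 _ _ hsp h).le
      have := h1 t
      have := h2 t ht.2
      have := hGd _ (hrG ht.1)
      omega
    obtain ⟨Z', P', hZ', hZZ', hηZ', hP', hP'Z, hsep'⟩ :=
      ih (Z ∪ D') D' (P ∪ (fun t => (a t, b t)) '' s') (hZ.union hD') hD'
        Set.subset_union_right (hP.union (hs'.image _))
        (by
          rintro (h | h)
          · exact hηZ h
          · have := hD'd _ h
            omega) (by omega) hD'd (fun y hy => Or.inl (hNZ y hy))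
        (by
          rintro p (hp | ⟨t, ht, rfl⟩)
          · exact Or.inl (hPZ p hp)
          · exact Or.inl (hDZ (hsD ht.1)))
        (by
          intro y hby hay
          rcases hby with hby | hby
          · have hayZ : a y ∉ Z := fun h => hay (Or.inl h)
            have hayD' : a y ∉ D' := fun h => hay (Or.inr h)
            rcases hsep y hby hayZ with ⟨p, hp, h⟩ | h
            · exact Or.inl ⟨p, Or.inl hp, h⟩
            · have hbN : b y ∉ N := fun h => hayZ (hNZ y h)
              obtain ⟨t, ht, hty⟩ := hsgen y h
              have hat := hty.map ha
              have hbt := hty.map hb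
              have hts' : t ∈ s' := ⟨ht, fun h => hayZ (hat.mem_closed hZ h),
                fun h => hbN (hbt.mem_closed hN h)⟩
              refine Or.inl ⟨_, Or.inr ⟨t, hts', rfl⟩, hat, hbt, fun hbad => hayD' ?_⟩
              have hbG : b y ∈ G := Set.mem_biUnion hts'
                ⟨specializes_iff_mem_closure.1 hbad, specializes_iff_mem_closure.1 hbt⟩
              obtain ⟨t2, ht2, ht2y⟩ := hrgen y hbG
              exact Set.mem_biUnion (show t2 ∈ r' from
                ⟨ht2, fun h => hbN ((ht2y.map hb).mem_closed hN h)⟩)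
                (specializes_iff_mem_closure.1 (ht2y.map ha))
          · exact Or.inr hby)
    exact ⟨Z', P', hZ', Set.subset_union_left.trans hZZ', hηZ', hP', hP'Z, hsep'⟩

lemma topo_main {X C : Type*} [TopologicalSpace X] [T0Space X] [TopologicalSpace C]
    [NoetherianSpace C] [QuasiSober C] (a b : C → X) (ha : Continuous a) (hb : Continuous b)
    (δX : X → ℕ) (δC : C → ℕ) (h1 : ∀ y, δX (a y) ≤ δC y)
    (N : Set X) (hN : IsClosed N) (h2 : ∀ y, b y ∉ N → δC y ≤ δX (b y))
    (h3 : ∀ x x', x ⤳ x' → ¬ x' ⤳ x → δX x' < δX x) (η : X) (hη : ∀ x, η ⤳ x)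
    (h4 : ∀ y, b y ∈ N → δC y < δX η) (hηN : η ∉ N)
    (Z1 : Set X) (hZ1 : IsClosed Z1) (hηZ1 : η ∉ Z1) :
    ∃ (Z' : Set X) (P' : Set (X × X)), IsClosed Z' ∧ Z1 ⊆ Z' ∧ η ∉ Z' ∧ P'.Finite ∧
        (∀ p ∈ P', p.2 ∈ Z') ∧
        ∀ y, b y ∈ Z' → a y ∉ Z' → ∃ p ∈ P', p.1 ⤳ a y ∧ p.2 ⤳ b y ∧ ¬ p.1 ⤳ b y := by
  obtain ⟨s, hs, hsN, hsgen⟩ := exists_finite_generic (b ⁻¹' N) (hN.preimage hb)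
  let T : Set X := ⋃ t ∈ s, closure {a t}
  have hT : IsClosed T := hs.isClosed_biUnion fun t _ => isClosed_closure
  have hηT : η ∉ T := by
    intro h
    simp only [T, Set.mem_iUnion] at h
    obtain ⟨t, ht, hx⟩ := h
    have e : η = a t := ((hη _).antisymm (specializes_iff_mem_closure.2 hx)).eq
    have := h4 t (hsN ht)
    have := h1 t
    rw [← e] at this
    omega
  obtain ⟨Z', P', h⟩ := topo_induction a b ha hb δX δC h1 N hN h2 h3 (δX η) η rfl (δX η)
    (N ∪ T ∪ Z1) (N ∪ T ∪ Z1) ∅ ((hN.union hT).union hZ1) ((hN.union hT).union hZ1) subset_rfl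
    Set.finite_empty (by
      rintro ((h | h) | h)
      exacts [hηN h, hηT h, hηZ1 h]) le_rfl
    (by
      intro x hx
      refine h3 _ _ (hη x) (fun hx' => ?_)
      have := hx'.mem_closed ((hN.union hT).union hZ1) hx
      rcases this with ((h | h) | h)
      exacts [hηN h, hηT h, hηZ1 h])
    (by
      intro y hy
      obtain ⟨t, ht, hty⟩ := hsgen y hy
      exact Or.inl (Or.inr (Set.mem_biUnion ht (specializes_iff_mem_closure.1 (hty.map ha)))))
    (by simp) (fun y hy _ => Or.inr hy)
  refine ⟨Z', P', h.1, Set.subset_union_right.trans h.2.1, h.2.2.1, h.2.2.2.1, h.2.2.2.2.1, ?_⟩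
  intro y hy hy'
  exact (h.2.2.2.2.2 y hy hy').resolve_right (by simp)

/-- Two morphisms over `S` to a separated `S`-scheme which agree on a dense subset of points
through a dominant morphism agree at all points. -/
lemma eq_of_dominant {T V Y S : Scheme.{u}} (p : Y ⟶ S) [IsSeparated p] (q₁ q₂ : T ⟶ Y)
    (hq : q₁ ≫ p = q₂ ≫ p) (j : V ⟶ T) (hj : DenseRange j.base) (h : j ≫ q₁ = j ≫ q₂) (t : T) :
    q₁ t = q₂ t := by
  have : IsClosedImmersion (equalizer.ι q₁ q₂) := by
    obtain ⟨l, hl1, hl2⟩ : ∃ l : T ⟶ pullback p p, l ≫ pullback.fst p p = q₁ ∧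
        l ≫ pullback.snd p p = q₂ :=
      ⟨pullback.lift q₁ q₂ hq, pullback.lift_fst _ _ _, pullback.lift_snd _ _ _⟩
    have hp : IsPullback (equalizer.ι q₁ q₂) (equalizer.ι q₁ q₂ ≫ q₁) l (pullback.diagonal p) := by
      refine ⟨⟨?_⟩, ⟨PullbackCone.IsLimit.mk _ (fun s => equalizer.lift s.fst ?_) ?_ ?_ ?_⟩⟩
      · apply pullback.hom_ext <;> simp [hl1, hl2]
        exact (equalizer.condition q₁ q₂).symm
      · have := s.condition
        have h1 := congr($this ≫ pullback.fst _ _)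
        have h2 := congr($this ≫ pullback.snd _ _)
        simp [hl1, hl2] at h1 h2
        rw [h1, h2]
      · intro s; simp
      · intro s
        have := s.condition
        have h1 := congr($this ≫ pullback.fst _ _)
        simp [hl1] at h1
        simp [h1]
      · intro s m h1 h2
        apply equalizer.hom_ext
        simpa using h1
    exact MorphismProperty.of_isPullback (P := @IsClosedImmersion) hp.flip inferInstance
  have hr : Set.range j.base ⊆ Set.range (equalizer.ι q₁ q₂).base := by
    rintro _ ⟨v, rfl⟩
    refine ⟨(equalizer.lift j h).base v, ?_⟩
    rw [← Scheme.Hom.comp_apply, equalizer.lift_ι]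
  have hcl : IsClosed (Set.range (equalizer.ι q₁ q₂).base) :=
    (equalizer.ι q₁ q₂).isClosedEmbedding.isClosed_range
  obtain ⟨e, rfl⟩ : t ∈ Set.range (equalizer.ι q₁ q₂).base :=
    hcl.closure_subset_iff.2 hr (hj t)
  change q₁ ((equalizer.ι q₁ q₂) e) = q₂ ((equalizer.ι q₁ q₂) e)
  rw [← Scheme.Hom.comp_apply, ← Scheme.Hom.comp_apply, equalizer.condition]

lemma dense_aux {T : Type*} [TopologicalSpace T] {V W : Type*} (U : Set T) (hU : IsOpen U)
    (f : V → T) (hf : DenseRange f) (g : W → U) (h : ∀ v, f v ∈ U → ∃ w, (g w : T) = f v) :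
    DenseRange g := by
  intro t
  rw [mem_closure_iff]
  rintro O hO htO
  obtain ⟨O', hO', rfl⟩ := isOpen_induced_iff.1 hO
  obtain ⟨v, hv⟩ := hf.exists_mem_open (hO'.inter hU) ⟨t, htO, t.2⟩
  obtain ⟨w, hw⟩ := h v hv.2
  exact ⟨g w, by show (g w : T) ∈ O'; rw [hw]; exact hv.1, ⟨w, rfl⟩⟩

lemma closure_graph {X P S : Scheme.{u}} (t : X ⟶ S) (p : P ⟶ S) [IsProper p]
    [NoetherianSpace X] (V W : X.Opens) (hVW : V ≤ W) (φ : W.toScheme ⟶ P)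
    (hφ : φ ≫ p = W.ι ≫ t) :
    ∃ (Y : Scheme.{u}) (π : Y ⟶ X) (q : Y ⟶ P), IsProper π ∧ IsIso (π ∣_ V) ∧
      ∀ (y : Y) (hy : π y ∈ W), q y = φ ⟨π y, hy⟩ := by
  obtain ⟨h, hfst, hsnd⟩ : ∃ h : V.toScheme ⟶ pullback t p, h ≫ pullback.fst t p = V.ι ∧
      h ≫ pullback.snd t p = X.homOfLE hVW ≫ φ :=
    ⟨pullback.lift V.ι (X.homOfLE hVW ≫ φ) (by simp [hφ]), pullback.lift_fst _ _ _,
      pullback.lift_snd _ _ _⟩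
  have : IsImmersion (h ≫ pullback.fst t p) := by rw [hfst]; infer_instance
  have : IsImmersion h := IsImmersion.of_comp h (pullback.fst t p)
  have : NoetherianSpace V.toScheme := V.ι.isOpenEmbedding.isInducing.noetherianSpace
  have : QuasiCompact h := inferInstance
  let π : h.image ⟶ X := h.imageι ≫ pullback.fst t p
  let j := h.toImage
  have hjπ : j ≫ π = V.ι := by simp [j, π, hfst]
  have hjd : DenseRange j.base := IsDominant.denseRange
  have hjm : ∀ v : V.toScheme, π (j v) = v.1 := fun v => by
    rw [← Scheme.Hom.comp_apply, hjπ]; rfl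
  refine ⟨h.image, π, h.imageι ≫ pullback.snd t p, inferInstance, ?_, ?_⟩
  · have hrange : ∀ y : h.image, π y ∈ V → y ∈ Set.range j.base := by
      intro y hy
      let T : h.image.Opens := π ⁻¹ᵁ V
      let jT : V.toScheme ⟶ T := IsOpenImmersion.lift T.ι j (by
        rintro _ ⟨v, rfl⟩
        simp only [Scheme.Opens.range_ι]
        show π (j v) ∈ V
        rw [hjm]; exact v.2)
      have hjT : jT ≫ T.ι = j := IsOpenImmersion.lift_fac _ _ _
      have key := eq_of_dominant π T.ι ((π ∣_ V) ≫ j) (by simp [T, hjπ]) jT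
        (dense_aux (T : Set h.image) T.2 j.base hjd jT.base (fun v _ => ⟨v, by
          rw [← hjT]; rfl⟩))
        (by
          rw [hjT, ← Category.assoc]
          have : jT ≫ (π ∣_ V) = 𝟙 _ := by
            rw [← cancel_mono V.ι]
            simp only [Category.assoc, morphismRestrict_ι]
            rw [← Category.assoc, hjT, hjπ]; simp
          rw [this]; simp) ⟨y, hy⟩
      refine ⟨(π ∣_ V) ⟨y, hy⟩, ?_⟩
      exact (key.trans (Scheme.Hom.comp_apply (π ∣_ V) j ⟨y, hy⟩)).symm
    have heq : π ⁻¹ᵁ V = j.opensRange := by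
      ext y
      constructor
      · intro hy; exact hrange y hy
      · rintro ⟨v, rfl⟩
        show π (j v) ∈ V
        rw [hjm]; exact v.2
    let jT : V.toScheme ⟶ (π ⁻¹ᵁ V) := IsOpenImmersion.lift (π ⁻¹ᵁ V).ι j (by
        rw [Scheme.Opens.range_ι, heq]; rfl)
    have hjT : jT ≫ (π ⁻¹ᵁ V).ι = j := IsOpenImmersion.lift_fac _ _ _
    have h1 : jT ≫ (π ∣_ V) = 𝟙 _ := by
      rw [← cancel_mono V.ι]
      simp only [Category.assoc, morphismRestrict_ι]
      rw [← Category.assoc, hjT, hjπ]; simp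
    have : IsIso jT := by
      have : IsOpenImmersion (jT ≫ (π ⁻¹ᵁ V).ι) := by rw [hjT]; infer_instance
      have : IsOpenImmersion jT := IsOpenImmersion.of_comp _ (π ⁻¹ᵁ V).ι
      have : Surjective jT := ⟨by
        rintro ⟨y, hy⟩
        obtain ⟨v, hv⟩ := hrange y hy
        refine ⟨v, Subtype.ext ?_⟩
        have e : (jT ≫ (π ⁻¹ᵁ V).ι) v = y := by rw [hjT]; exact hv
        exact e⟩
      exact (isIso_iff_isOpenImmersion_and_epi_base jT).2 ⟨inferInstance,
        (TopCat.epi_iff_surjective _).2 jT.surjective⟩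
    have : IsIso (jT ≫ (π ∣_ V)) := by rw [h1]; infer_instance
    exact IsIso.of_isIso_comp_left jT _
  · intro y hy
    let T : h.image.Opens := π ⁻¹ᵁ W
    let jT : V.toScheme ⟶ T := IsOpenImmersion.lift T.ι j (by
        rintro _ ⟨v, rfl⟩
        simp only [Scheme.Opens.range_ι]
        show π (j v) ∈ W
        rw [hjm]; exact hVW v.2)
    have hjT : jT ≫ T.ι = j := IsOpenImmersion.lift_fac _ _ _
    have key := eq_of_dominant p (T.ι ≫ h.imageι ≫ pullback.snd t p) ((π ∣_ W) ≫ φ)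
        (by
          have e : ((π ∣_ W) ≫ φ) ≫ p = T.ι ≫ π ≫ t := by
            rw [Category.assoc, hφ]
            exact morphismRestrict_ι_assoc π W t
          rw [e]
          simp [π, pullback.condition]) jT
        (dense_aux (T : Set h.image) T.2 j.base hjd jT.base (fun v _ => ⟨v, by
          rw [← hjT]; rfl⟩))
        (by
          rw [← Category.assoc, hjT, ← Category.assoc, ← Category.assoc]
          have : jT ≫ (π ∣_ W) = X.homOfLE hVW := by
            rw [← cancel_mono W.ι]
            simp only [Category.assoc, morphismRestrict_ι]
            rw [← Category.assoc, hjT, hjπ]; simp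
          rw [this, ← hsnd]; simp [j]) ⟨y, hy⟩
    have e : (π ∣_ W) ⟨y, hy⟩ = ⟨π y, hy⟩ := Subtype.ext (morphismRestrict_base_coe π W ⟨y, hy⟩)
    exact (Scheme.Hom.comp_apply T.ι (h.imageι ≫ pullback.snd t p) ⟨y, hy⟩).symm.trans
      (key.trans ((Scheme.Hom.comp_apply (π ∣_ W) φ ⟨y, hy⟩).trans (congrArg φ e)))

section projmap
open Proj
variable {σ : Type*} {A : Type u} [CommRing A] [SetLike σ A] [AddSubgroupClass σ A]
  (𝒜 : ℕ → σ) [GradedRing 𝒜]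

lemma toBasicOpen_desc {X : Scheme.{u}} (f : A →+* Γ(X, ⊤)) {d : ℕ} {t : A} (h0d : 0 < d)
    (hd : t ∈ 𝒜 d) :
    ∃ (u : (X.basicOpen (f t)).toScheme ⟶ Spec (.of (Localization.Away (f t))))
      (g : Localization.Away t →+* Localization.Away (f t)),
      g.comp (algebraMap _ _) = (algebraMap _ _).comp f ∧
      u ≫ Spec.map (CommRingCat.ofHom (algebraMap _ _)) = (X.basicOpen (f t)).ι ≫ X.toSpecΓ ∧
      toBasicOpenOfGlobalSections 𝒜 f rfl h0d hd ≫ (basicOpen 𝒜 t).ι =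
        u ≫ Spec.map (CommRingCat.ofHom (g.comp
          (algebraMap (HomogeneousLocalization.Away 𝒜 t) (Localization.Away t)))) ≫
          awayι 𝒜 t hd h0d := by
  refine ⟨(X.isoOfEq (X.toSpecΓ_preimage_basicOpen (f t))).inv ≫ X.toSpecΓ ∣_ _ ≫
    (basicOpenIsoSpecAway _).hom, IsLocalization.map (M := .powers t) (T := .powers (f t)) _ f (by
      rw [← Submonoid.map_le_iff_le_comap, Submonoid.map_powers]), ?_, ?_, ?_⟩
  · exact IsLocalization.map_comp _
  · simp only [Category.assoc, basicOpenIsoSpecAway, IsOpenImmersion.isoOfRangeEq_hom_fac]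
    have := Scheme.isoOfEq_inv_ι X (X.toSpecΓ_preimage_basicOpen (f t))
    rw [← this, Category.assoc]
    congr 1
    exact morphismRestrict_ι _ _
  · simp only [toBasicOpenOfGlobalSections, Category.assoc, basicOpenIsoSpec_inv_ι]

lemma exists_proj_map {X : Scheme.{u}} (f : A →+* Γ(X, ⊤))
    (hcov : IsOpenCover (fun ir : Σ' i r, 0 < i ∧ r ∈ 𝒜 i ↦ X.basicOpen (f ir.2.1))) :
    ∃ φ : X ⟶ Proj 𝒜, φ ≫ toSpecZero 𝒜 =
        X.toSpecΓ ≫ Spec.map (CommRingCat.ofHom (f.comp (algebraMap _ _))) ∧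
      ∀ (n : ℕ) (r : A), 0 < n → r ∈ 𝒜 n → ∀ x : X, φ x ∈ basicOpen 𝒜 r →
        x ∈ X.basicOpen (f r) := by
  have hg : ∀ x y : (Σ' i r, 0 < i ∧ r ∈ 𝒜 i),
      pullback.fst (X.basicOpen (f x.2.1)).ι (X.basicOpen (f y.2.1)).ι ≫
      (toBasicOpenOfGlobalSections 𝒜 f rfl x.2.2.1 x.2.2.2 ≫ Scheme.Opens.ι _) =
      pullback.snd (X.basicOpen (f x.2.1)).ι (X.basicOpen (f y.2.1)).ι ≫
      (toBasicOpenOfGlobalSections 𝒜 f rfl y.2.2.1 y.2.2.2 ≫ Scheme.Opens.ι _) := by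
    intro x y
    let e : pullback (X.basicOpen (f x.2.1)).ι (X.basicOpen (f y.2.1)).ι ≅ (X.basicOpen (f (x.snd.fst * y.snd.fst))) :=
      (isPullback_opens_inf (X.basicOpen (f x.2.1)) (X.basicOpen (f y.2.1))).isoPullback.symm
        ≪≫ X.isoOfEq (by simp)
    have e1 : e.inv ≫ pullback.fst (X.basicOpen (f x.2.1)).ι (X.basicOpen (f y.2.1)).ι = X.homOfLE (by simp [X.basicOpen_mul]) := by
      rw [← cancel_mono (Scheme.Opens.ι _)]
      simp [e, Scheme.isoOfEq_inv]
    have e2 : e.inv ≫ pullback.snd (X.basicOpen (f x.2.1)).ι (X.basicOpen (f y.2.1)).ι = X.homOfLE (by simp [X.basicOpen_mul]) := by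
      simp [e, Scheme.isoOfEq_inv]
    rw [← cancel_epi e.inv, ← Category.assoc, ← Category.assoc e.inv, e1, e2]
    trans toBasicOpenOfGlobalSections 𝒜 f rfl (Nat.add_pos_left x.2.2.1 y.1)
      (SetLike.mul_mem_graded x.2.2.2 y.2.2.2) ≫ (Scheme.Opens.ι _)
    · exact homOfLE_toBasicOpenOfGlobalSections_ι 𝒜 f rfl rfl y.2.2.2
    · exact (homOfLE_toBasicOpenOfGlobalSections_ι 𝒜 f (mul_comm _ _) (add_comm _ _) x.2.2.2).symm
  let 𝒰 : X.OpenCover := X.openCoverOfIsOpenCover _ hcov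
  let φ : X ⟶ Proj 𝒜 := 𝒰.glueMorphisms (fun ri ↦ toBasicOpenOfGlobalSections 𝒜 f rfl ri.2.2.1 ri.2.2.2 ≫ Scheme.Opens.ι _) hg
  have hφ : ∀ i : (Σ' i r, 0 < i ∧ r ∈ 𝒜 i), (X.basicOpen (f i.2.1)).ι ≫ φ = toBasicOpenOfGlobalSections 𝒜 f rfl i.2.2.1 i.2.2.2 ≫ Scheme.Opens.ι _ := fun i => 𝒰.ι_glueMorphisms _ _ i
  clear_value φ
  have hext : ∀ {Z : Scheme.{u}} (a b : X ⟶ Z), (∀ i : (Σ' i r, 0 < i ∧ r ∈ 𝒜 i), (X.basicOpen (f i.2.1)).ι ≫ a = (X.basicOpen (f i.2.1)).ι ≫ b) → a = b := fun a b h => 𝒰.hom_ext _ _ h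
  clear_value 𝒰
  refine ⟨φ, ?_, ?_⟩
  · refine hext _ _ fun x ↦ ?_
    obtain ⟨u, g, hgf, hu, h⟩ := toBasicOpen_desc 𝒜 f x.2.2.1 x.2.2.2
    rw [← Category.assoc, hφ, h]
    simp only [Category.assoc, awayι_toSpecZero]
    rw [← Category.assoc _ X.toSpecΓ, ← hu, Category.assoc, ← Spec.map_comp, ← Spec.map_comp]
    congr 2
    ext z
    have := congr($hgf (algebraMap _ _ z))
    simp at this ⊢
    rw [← this]
    congr 1
  · intro n r hn hr x hx
    obtain ⟨i, hi⟩ := hcov.exists_mem x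
    obtain ⟨u, g, hgf, hu, h⟩ := toBasicOpen_desc 𝒜 f i.2.2.1 i.2.2.2
    obtain ⟨z, hz⟩ : ∃ z : (X.basicOpen (f i.2.1)).toScheme, (X.basicOpen (f i.2.1)).ι z = x :=
      ⟨⟨x, hi⟩, rfl⟩
    have h1 : φ x = awayι 𝒜 i.2.1 i.2.2.2 i.2.2.1 (Spec.map (CommRingCat.ofHom (g.comp
          (algebraMap (HomogeneousLocalization.Away 𝒜 i.2.1) (Localization.Away i.2.1)))) (u z)) := by
      rw [← Scheme.Hom.comp_apply, ← Scheme.Hom.comp_apply, ← h, ← hφ, Scheme.Hom.comp_apply, hz]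
    have h3 : Spec.map (CommRingCat.ofHom (algebraMap _ _)) (u z) = X.toSpecΓ x := by
      rw [← Scheme.Hom.comp_apply, hu, Scheme.Hom.comp_apply, hz]
    rw [h1] at hx
    have h2 := Proj.awayι_preimage_basicOpen (𝒜 := 𝒜) i.2.2.2 i.2.2.1 hr hn
    have hx' : Spec.map (CommRingCat.ofHom (g.comp
          (algebraMap (HomogeneousLocalization.Away 𝒜 i.2.1) (Localization.Away i.2.1)))) (u z) ∈
        awayι 𝒜 i.2.1 i.2.2.2 i.2.2.1 ⁻¹ᵁ basicOpen 𝒜 r := hx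
    rw [h2] at hx'
    rw [← Scheme.toSpecΓ_preimage_basicOpen]
    change X.toSpecΓ x ∈ PrimeSpectrum.basicOpen (f r)
    rw [← h3]
    intro hmem
    apply hx'
    change g _ ∈ (u z).asIdeal
    change algebraMap _ _ (f r) ∈ (u z).asIdeal at hmem
    have e := congr($hgf r)
    simp only [RingHom.comp_apply] at e
    rw [← e] at hmem
    have ht : IsUnit (g (algebraMap _ _ i.2.1)) := by
      apply IsUnit.map
      exact IsLocalization.Away.algebraMap_isUnit i.2.1
    refine ((u z).isPrime.mem_or_mem (y := g (algebraMap _ _ i.2.1) ^ n) ?_).resolve_right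
      fun hh => (u z).isPrime.ne_top (Ideal.eq_top_of_isUnit_mem _ hh (ht.pow _))
    rw [← map_pow, ← map_mul]
    have e2 : (algebraMap (HomogeneousLocalization.Away 𝒜 i.2.1) (Localization.Away i.2.1))
      (HomogeneousLocalization.Away.isLocalizationElem i.2.2.2 hr) * (algebraMap A (Localization.Away i.2.1)) i.2.1 ^ n =
        (algebraMap A (Localization.Away i.2.1) r) ^ i.1 := by
      rw [HomogeneousLocalization.algebraMap_apply, HomogeneousLocalization.Away.isLocalizationElem,
        HomogeneousLocalization.Away.val_mk, Localization.mk_eq_mk', ← map_pow, ← map_pow]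
      exact IsLocalization.mk'_spec _ _ (⟨i.2.1 ^ n, _⟩ : Submonoid.powers i.2.1)
    rw [e2, map_pow]
    exact Ideal.pow_mem_of_mem _ hmem _ i.2.2.1
end projmap

lemma exists_cut {X : Scheme.{u}} [IsLocallyNoetherian X] (W : X.Opens) (hW : IsAffineOpen W)
    (E : Set X) (hE : IsClosed E) :
    ∃ S : Finset Γ(X, W), ∀ x ∈ W, x ∈ E ↔ ∀ s ∈ S, x ∉ X.basicOpen s := by
  have := IsLocallyNoetherian.component_noetherian ⟨W, hW⟩
  obtain ⟨I, hI⟩ := (PrimeSpectrum.isClosed_iff_zeroLocus_ideal (hW.fromSpec.base ⁻¹' E)).1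
    (hE.preimage hW.fromSpec.continuous)
  obtain ⟨S, hS⟩ := (isNoetherianRing_iff_ideal_fg _).1 this I
  refine ⟨S, fun x hx => ?_⟩
  obtain ⟨z, rfl⟩ : x ∈ Set.range hW.fromSpec.base := by
    rw [hW.range_fromSpec]; exact hx
  have h1 : hW.fromSpec.base z ∈ E ↔ z ∈ PrimeSpectrum.zeroLocus (I : Set Γ(X, W)) := by
    rw [← hI]; rfl
  rw [h1, ← hS, PrimeSpectrum.zeroLocus_span]
  have h2 : ∀ s : Γ(X, W), hW.fromSpec.base z ∈ X.basicOpen s ↔ s ∉ z.asIdeal := by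
    intro s
    have := hW.fromSpec_preimage_basicOpen s
    change z ∈ hW.fromSpec ⁻¹ᵁ X.basicOpen s ↔ _
    rw [this]; rfl
  simp only [h2, not_not]
  rfl

lemma projZero_finiteType (R ι : Type u) [CommRing R] [Finite ι] :
    Algebra.FiniteType (MvPolynomial.homogeneousSubmodule ι R 0) (MvPolynomial ι R) := by
  have : IsScalarTower R (MvPolynomial.homogeneousSubmodule ι R 0) (MvPolynomial ι R) := by
    refine ⟨?_⟩
    intro x y z
    exact smul_assoc x (y : MvPolynomial ι R) z
  exact Algebra.FiniteType.of_restrictScalars_finiteType R _ _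

lemma exists_blowup_family {X : Scheme.{u}} [NoetherianSpace X] (V W' W : X.Opens)
    (hVW : V ≤ W') (hWW : W' ≤ W) {ι : Type u} [Finite ι] (s : ι → Γ(X, W))
    (hs : ∀ x ∈ W', ∃ i, x ∈ X.basicOpen (s i)) :
    ∃ (Y : Scheme.{u}) (π : Y ⟶ X) (O : ι → Y.Opens), IsProper π ∧ IsIso (π ∣_ V) ∧
      (∀ y, ∃ i, y ∈ O i) ∧ ∀ i, ∀ y ∈ O i, π y ∈ W' → π y ∈ X.basicOpen (s i) := by
  let R : Type u := Γ(X, ⊤)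
  let 𝒜 := MvPolynomial.homogeneousSubmodule ι R
  have : GradedRing 𝒜 := MvPolynomial.gradedAlgebra
  have hle' : (⊤ : W'.toScheme.Opens) ≤ W'.ι ⁻¹ᵁ W := by
    rintro x -
    exact hWW x.2
  let f : MvPolynomial ι R →+* Γ(W'.toScheme, ⊤) :=
    MvPolynomial.eval₂Hom (W'.ι.appTop.hom) (fun i => (W'.ι.appLE W ⊤ hle').hom (s i))
  have hfX : ∀ i (x : W'.toScheme), x ∈ W'.toScheme.basicOpen (f (MvPolynomial.X i)) ↔
      W'.ι x ∈ X.basicOpen (s i) := by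
    intro i x
    have : f (MvPolynomial.X i) = (W'.ι.appLE W ⊤ hle').hom (s i) := by simp [f]
    rw [this]
    have h2 : W'.toScheme.basicOpen ((W'.ι.appLE W ⊤ hle').hom (s i)) =
        ⊤ ⊓ W'.ι ⁻¹ᵁ X.basicOpen (s i) := by
      rw [Scheme.preimage_basicOpen]
      exact Scheme.basicOpen_res _ _ _
    constructor
    · intro h
      rw [h2] at h
      exact h.2
    · intro h
      rw [h2]
      exact ⟨trivial, h⟩
  have hdeg : ∀ i : ι, (MvPolynomial.X i : MvPolynomial ι R) ∈ 𝒜 1 := fun i =>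
    MvPolynomial.isHomogeneous_X R i
  have hcov : IsOpenCover (fun ir : Σ' i r, 0 < i ∧ r ∈ 𝒜 i ↦
      W'.toScheme.basicOpen (f ir.2.1)) := by
    rw [IsOpenCover, eq_top_iff]
    rintro x -
    obtain ⟨i, hi⟩ := hs (W'.ι x) x.2
    exact Opens.mem_iSup.2 ⟨⟨1, MvPolynomial.X i, one_pos, hdeg i⟩, (hfX i x).2 hi⟩
  obtain ⟨φ, hφ1, hφ2⟩ := exists_proj_map 𝒜 f hcov
  have : Algebra.FiniteType (𝒜 0) (MvPolynomial ι R) := projZero_finiteType R ι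
  let ρ : 𝒜 0 →+* R := MvPolynomial.constantCoeff.comp (algebraMap (𝒜 0) (MvPolynomial ι R))
  have hρ : f.comp (algebraMap (𝒜 0) (MvPolynomial ι R)) = (W'.ι.appTop.hom).comp ρ := by
    ext ⟨z, hz⟩
    have h0 : z = MvPolynomial.C (MvPolynomial.coeff 0 z) :=
      MvPolynomial.totalDegree_eq_zero_iff_eq_C.1 (Nat.le_zero.1 (MvPolynomial.IsHomogeneous.totalDegree_le hz))
    change f z = (W'.ι.appTop.hom) (MvPolynomial.constantCoeff z)
    rw [h0]
    simp [f]
  obtain ⟨Y, π, q, hπ, hV, hq⟩ := closure_graph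
    (X.toSpecΓ ≫ Spec.map (CommRingCat.ofHom ρ)) (Proj.toSpecZero 𝒜) V W' hVW φ (by
      rw [hφ1, hρ, CommRingCat.ofHom_comp, Spec.map_comp, ← Category.assoc, ← Category.assoc]
      congr 1
      exact (Scheme.toSpecΓ_naturality W'.ι).symm)
  refine ⟨Y, π, fun i => q ⁻¹ᵁ Proj.basicOpen 𝒜 (MvPolynomial.X i), hπ, hV, ?_, ?_⟩
  · intro y
    have := Proj.iSup_basicOpen_eq_top' 𝒜 (MvPolynomial.X : ι → MvPolynomial ι R)
      (fun i => ⟨1, hdeg i⟩) (by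
        rw [eq_top_iff]
        rintro z -
        have : z ∈ Algebra.adjoin R (Set.range (MvPolynomial.X : ι → MvPolynomial ι R)) := by
          rw [MvPolynomial.adjoin_range_X]; trivial
        induction this using Algebra.adjoin_induction with
        | mem x hx => exact Algebra.subset_adjoin hx
        | algebraMap r =>
          exact Subalgebra.algebraMap_mem _ (⟨MvPolynomial.C r, MvPolynomial.isHomogeneous_C _ _⟩ : 𝒜 0)
        | add x y _ _ hx hy => exact add_mem hx hy
        | mul x y _ _ hx hy => exact mul_mem hx hy)
    have h : q y ∈ (⊤ : (Proj 𝒜).Opens) := trivial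
    rw [← this] at h
    obtain ⟨i, hi⟩ := Opens.mem_iSup.1 h
    exact ⟨i, hi⟩
  · intro i y hy hW
    have h1 : q y ∈ Proj.basicOpen 𝒜 (MvPolynomial.X i) := hy
    rw [hq y hW] at h1
    exact (hfX i _).1 (hφ2 1 _ one_pos (hdeg i) _ h1)

lemma sep_one {X : Scheme.{u}} [IsLocallyNoetherian X] [NoetherianSpace X] (V W : X.Opens)
    (hVW : V ≤ W) (hW : IsAffineOpen W) (E E'' : Set X) (hE : IsClosed E) (hE'' : IsClosed E'')
    (hV : ∀ x ∈ V, x ∉ E'') :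
    ∃ (Y : Scheme.{u}) (π : Y ⟶ X) (O1 O2 : Y.Opens), IsProper π ∧ IsIso (π ∣_ V) ∧
      (∀ y, y ∈ O1 ∨ y ∈ O2) ∧ (∀ y ∈ O1, π y ∈ V → π y ∉ E) ∧
      (∀ y ∈ O2, π y ∈ W → π y ∈ E'' → π y ∈ E) := by
  classical
  obtain ⟨S, hS⟩ := exists_cut W hW E hE
  obtain ⟨S'', hS''⟩ := exists_cut W hW E'' hE''
  let W' : X.Opens := W ⊓ ⟨(E ∩ E'')ᶜ, (hE.inter hE'').isOpen_compl⟩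
  obtain ⟨Y, π, O, h1, h2, h3, h4⟩ := exists_blowup_family V W' W
    (fun x hx => ⟨hVW hx, fun h => hV x hx h.2⟩) inf_le_left
    (ι := S ⊕ S'') (Sum.elim (fun s => s.1) (fun s => s.1)) (by
      rintro x ⟨hx, hx'⟩
      by_contra! hcon
      exact hx' ⟨(hS x hx).2 fun s hs => hcon (Sum.inl ⟨s, hs⟩),
        (hS'' x hx).2 fun s hs => hcon (Sum.inr ⟨s, hs⟩)⟩)
  refine ⟨Y, π, ⨆ s, O (Sum.inl s), ⨆ s, O (Sum.inr s), h1, h2, ?_, ?_, ?_⟩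
  · intro y
    obtain ⟨i | i, hi⟩ := h3 y
    · exact Or.inl (Opens.mem_iSup.2 ⟨i, hi⟩)
    · exact Or.inr (Opens.mem_iSup.2 ⟨i, hi⟩)
  · intro y hy hyV hyE
    obtain ⟨i, hi⟩ := Opens.mem_iSup.1 hy
    exact (hS _ (hVW hyV)).1 hyE i i.2 (h4 _ y hi ⟨hVW hyV, fun h => hV _ hyV h.2⟩)
  · intro y hy hyW hyE''
    by_contra hyE
    obtain ⟨i, hi⟩ := Opens.mem_iSup.1 hy
    exact (hS'' _ hyW).1 hyE'' i i.2 (h4 _ y hi ⟨hyW, fun h => hyE h.1⟩)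

lemma isIso_restrict_of_isPullback {X Y X' Y' : Scheme.{u}} {f : Y ⟶ X} {g : X' ⟶ X}
    {f' : Y' ⟶ X'} {g' : Y' ⟶ Y} (h : IsPullback g' f' f g) (V : X.Opens) (hV : IsIso (f ∣_ V)) :
    IsIso (f' ∣_ (g ⁻¹ᵁ V)) := by
  have h1 := (isPullback_morphismRestrict f' (g ⁻¹ᵁ V)).flip
  have h2 := h1.paste_horiz h
  have h3 := (isPullback_morphismRestrict f V).flip
  have h4 := (morphismRestrict_ι g V)
  have h5 := IsPullback.of_right (h₁₁ := h3.lift (((f' ⁻¹ᵁ (g ⁻¹ᵁ V)).ι ≫ g')) ((f' ∣_ (g ⁻¹ᵁ V)) ≫ (g ∣_ V)) (by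
      simp [h.w]))  (v₁₁ := f' ∣_ (g ⁻¹ᵁ V)) (h₂₁ := g ∣_ V) (h₁₂ := (f ⁻¹ᵁ V).ι) (v₁₃ := f) (v₁₂ := f ∣_ V) (h₂₂ := V.ι) (by
      rw [h3.lift_fst, h4]; exact h2) (by rw [h3.lift_snd]) h3
  exact MorphismProperty.of_isPullback (P := MorphismProperty.isomorphisms _) h5 hV

lemma combine {X : Scheme.{u}} (V : X.Opens) {α : Type*}
    (Q : α → ∀ Y : Scheme.{u}, (Y ⟶ X) → Prop)
    (hQ : ∀ l Y π Y' (g : Y' ⟶ Y), Q l Y π → Q l Y' (g ≫ π))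
    (h : ∀ l, ∃ Y π, IsProper π ∧ IsIso (π ∣_ V) ∧ Q l Y π) (L : List α) :
    ∃ Y π, IsProper π ∧ IsIso (π ∣_ V) ∧ ∀ l ∈ L, Q l Y π := by
  induction L with
  | nil =>
    exact ⟨X, 𝟙 X, inferInstance, inferInstance, by simp⟩
  | cons l L ih =>
    obtain ⟨Y1, π1, h1, h2, h3⟩ := ih
    obtain ⟨Y2, π2, k1, k2, k3⟩ := h l
    refine ⟨pullback π1 π2, pullback.fst π1 π2 ≫ π1, inferInstance, ?_, ?_⟩
    · rw [morphismRestrict_comp]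
      have := isIso_restrict_of_isPullback (IsPullback.of_hasPullback π1 π2).flip V k2
      exact IsIso.comp_isIso' this h2
    · intro m hm
      rcases List.mem_cons.1 hm with rfl | hm
      · rw [pullback.condition]
        exact hQ _ _ _ _ _ k3
      · exact hQ _ _ _ _ _ (h3 m hm)

lemma geo_main {X : Scheme.{u}} [IsLocallyNoetherian X] [NoetherianSpace X] (V : X.Opens)
    (𝒲 : Set X.Opens) (h𝒲 : 𝒲.Finite) (hV𝒲 : ∀ W ∈ 𝒲, IsAffineOpen W ∧ V ≤ W)
    (hcov : ∀ x : X, ∃ W ∈ 𝒲, x ∈ W) (P : Set (X × X)) (hP : P.Finite)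
    (hPV : ∀ p ∈ P, p.2 ∉ V) :
    ∃ (Y : Scheme.{u}) (π : Y ⟶ X), IsProper π ∧ IsIso (π ∣_ V) ∧
      ∀ y : Y, ∃ U : Set Y, IsOpen U ∧ y ∈ U ∧ ∀ y1 ∈ U, ∀ y2 ∈ U, π y1 ∈ V →
        ∀ p ∈ P, p.1 ⤳ π y1 → p.2 ⤳ π y2 → p.1 ⤳ π y2 := by
  let Q : (𝒲 × P) → ∀ Y : Scheme.{u}, (Y ⟶ X) → Prop := fun l Y π =>
    ∀ y : Y, π y ∈ l.1.1 → ∃ U : Set Y, IsOpen U ∧ y ∈ U ∧ ∀ y1 ∈ U, ∀ y2 ∈ U, π y1 ∈ V →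
        l.2.1.1 ⤳ π y1 → l.2.1.2 ⤳ π y2 → l.2.1.1 ⤳ π y2
  have : Finite 𝒲 := h𝒲
  have : Finite P := hP
  have := Fintype.ofFinite (𝒲 × P)
  obtain ⟨Y, π, h1, h2, h3⟩ := combine V Q (by
    intro l Y π Y' g h y hy
    obtain ⟨U, hU, hyU, h⟩ := h (g y) (by rwa [Scheme.Hom.comp_apply] at hy)
    refine ⟨g.base ⁻¹' U, hU.preimage g.continuous, hyU, fun y1 hy1 y2 hy2 => ?_⟩
    rw [Scheme.Hom.comp_apply, Scheme.Hom.comp_apply]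
    exact h _ hy1 _ hy2) (by
    rintro ⟨⟨W, hW⟩, ⟨⟨e, e''⟩, hp⟩⟩
    obtain ⟨Y, π, O1, O2, h1, h2, h3, h4, h5⟩ := sep_one V W (hV𝒲 W hW).2 (hV𝒲 W hW).1
      (closure {e}) (closure {e''}) isClosed_closure isClosed_closure (fun x hx hxe =>
        hPV _ hp ((specializes_iff_mem_closure.2 hxe).mem_open V.2 hx))
    refine ⟨Y, π, h1, h2, fun y hy => ?_⟩
    rcases h3 y with h | h
    · exact ⟨O1, O1.2, h, fun y1 hy1 y2 hy2 hV hs _ =>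
        absurd (specializes_iff_mem_closure.1 hs) (h4 y1 hy1 hV)⟩
    · refine ⟨O2 ∩ π.base ⁻¹' W, O2.2.inter (W.2.preimage π.continuous), ⟨h, hy⟩,
        fun y1 hy1 y2 hy2 hV hs hs' => ?_⟩
      exact specializes_iff_mem_closure.2 (h5 y2 hy2.1 hy2.2 (specializes_iff_mem_closure.1 hs')))
    Finset.univ.toList
  refine ⟨Y, π, h1, h2, fun y => ?_⟩
  obtain ⟨W, hW, hyW⟩ := hcov (π y)
  choose U hU hyU h using fun p : P => h3 (⟨W, hW⟩, p) (by simp) y hyW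
  refine ⟨⋂ p, U p, isOpen_iInter_of_finite hU, Set.mem_iInter.2 hyU, ?_⟩
  intro y1 hy1 y2 hy2 hV p hp
  exact h ⟨p, hp⟩ y1 (Set.mem_iInter.1 hy1 _) y2 (Set.mem_iInter.1 hy2 _) hV

lemma ringKrullDim_le_of_integral {R S : Type*} [CommRing R] [CommRing S] [Algebra R S]
    [Algebra.IsIntegral R S] (hinj : Function.Injective (algebraMap R S)) :
    ringKrullDim R ≤ ringKrullDim S := by
  refine iSup_le fun l => ?_
  obtain ⟨P, -, hP, hPo⟩ := Ideal.exists_ideal_over_prime_of_isIntegral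
    (RelSeries.head l).asIdeal (⊥ : Ideal S) (by
      rw [Ideal.comap_bot_of_injective _ hinj]; exact bot_le)
  haveI : P.LiesOver (RelSeries.head l).asIdeal := ⟨hPo.symm⟩
  obtain ⟨L, hL, -⟩ := Ideal.exists_ltSeries_of_hasGoingUp l P
  rw [← hL]
  exact le_iSup (fun p : LTSeries (PrimeSpectrum S) => (p.length : WithBot ℕ∞)) L

lemma trd_le_dim {k A K : Type u} [Field k] [CommRing A] [Field K] (g : k →+* A)
    (hg : g.FiniteType) (f : A →+* K) (hf : HFrac f) :
    (((trd (f.comp g)).toNat : ℕ∞) : WithBot ℕ∞) ≤ ringKrullDim A := by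
  letI := g.toAlgebra
  letI := (f.comp g).toAlgebra
  let f' : A →ₐ[k] K := ⟨f, fun _ => rfl⟩
  haveI : Algebra.FiniteType k A := hg
  haveI : Algebra.FiniteType k f'.range :=
    Algebra.FiniteType.of_surjective f'.rangeRestrict f'.rangeRestrict_surjective
  haveI : FaithfulSMul k f'.range :=
    (faithfulSMul_iff_algebraMap_injective _ _).2 (algebraMap k f'.range).injective
  obtain ⟨s, N, hN, hNi⟩ := exists_integral_inj_algHom_of_fg k f'.range
  letI : Algebra (MvPolynomial (Fin s) k) f'.range := N.toRingHom.toAlgebra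
  haveI : IsScalarTower k (MvPolynomial (Fin s) k) f'.range :=
    IsScalarTower.of_algebraMap_eq (fun x => (N.commutes x).symm)
  haveI : Algebra.IsIntegral (MvPolynomial (Fin s) k) f'.range := ⟨hNi⟩
  haveI : FaithfulSMul (MvPolynomial (Fin s) k) f'.range :=
    (faithfulSMul_iff_algebraMap_injective _ _).2 hN
  have h1 := ringKrullDim_le_of_integral (R := MvPolynomial (Fin s) k) (S := f'.range) hN
  have h2 : ringKrullDim f'.range ≤ ringKrullDim A :=
    ringKrullDim_le_of_surjective f'.rangeRestrict.toRingHom f'.rangeRestrict_surjective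
  have h3 : ringKrullDim (MvPolynomial (Fin s) k) = s := by
    rw [MvPolynomial.ringKrullDim_of_isNoetherianRing, ringKrullDim_eq_zero_of_field]
    simp
  have h4 : trd (f.comp g) = s := by
    change Algebra.trdeg k K = s
    haveI := HFrac.isAlgebraic f' hf (Set.range f') (by
      rw [← AlgHom.coe_range, Algebra.adjoin_eq])
    haveI : Algebra.IsAlgebraic f'.range K := by
      have h5 : Algebra.adjoin k (Set.range f') = f'.range := by
        rw [← AlgHom.coe_range, Algebra.adjoin_eq]
      rw [← h5]; infer_instance
    rw [← _root_.trdeg_add_eq k f'.range, _root_.trdeg_eq_zero (R := f'.range), add_zero,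
      ← _root_.trdeg_add_eq k (MvPolynomial (Fin s) k),
      _root_.trdeg_eq_zero (R := MvPolynomial (Fin s) k), add_zero,
      MvPolynomial.trdeg_of_isDomain]
    simp
  rw [h4, Cardinal.toNat_natCast]
  rw [h3] at h1
  exact h1.trans h2

lemma le_pre_top {X Y : Scheme.{u}} (f : Y ⟶ X) (V : Y.Opens) : V ≤ f ⁻¹ᵁ ⊤ := fun _ _ => trivial

noncomputable def strHom {k : Type u} [CommRing k] {X : Scheme.{u}} (s : X ⟶ Spec (.of k))
    (U : X.Opens) : k →+* Γ(X, U) :=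
  ((Scheme.ΓSpecIso (.of k)).inv ≫ s.appLE ⊤ U (le_pre_top s U)).hom

noncomputable def resHom {k : Type u} [CommRing k] {X : Scheme.{u}} (s : X ⟶ Spec (.of k))
    (x : X) : k →+* X.residueField x :=
  (X.evaluation ⊤ x trivial).hom.comp (strHom s ⊤)

lemma evaluation_map {X : Scheme.{u}} {U V : X.Opens} (h : V ≤ U) (x : X) (hx : x ∈ V) :
    X.presheaf.map (homOfLE h).op ≫ X.evaluation V x hx = X.evaluation U x (h hx) := by
  simp only [← Scheme.germ_residue]
  rw [TopCat.Presheaf.germ_res_assoc]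

lemma evaluation_appLE {X Y : Scheme.{u}} (f : Y ⟶ X) {U : X.Opens} {V : Y.Opens}
    (h : V ≤ f ⁻¹ᵁ U) (y : Y) (hy : y ∈ V) (hy' : f y ∈ U) :
    f.appLE U V h ≫ Y.evaluation V y hy = X.evaluation U (f y) hy' ≫ f.residueFieldMap y := by
  rw [Scheme.evaluation_naturality, Scheme.Hom.appLE, Category.assoc]
  congr 1
  exact evaluation_map h y hy

lemma resHom_eq {k : Type u} [CommRing k] {X : Scheme.{u}} (s : X ⟶ Spec (.of k))
    (U : X.Opens) (x : X) (hx : x ∈ U) :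
    resHom s x = (X.evaluation U x hx).hom.comp (strHom s U) := by
  rw [resHom, strHom, strHom, ← CommRingCat.hom_comp, ← CommRingCat.hom_comp]
  congr 1
  rw [Category.assoc, Category.assoc, ← evaluation_map (le_top : U ≤ ⊤) x hx,
    Scheme.Hom.appLE_map_assoc]

lemma resHom_comp {k : Type u} [CommRing k] {X Y : Scheme.{u}} (s : X ⟶ Spec (.of k))
    (f : Y ⟶ X) (y : Y) :
    resHom (f ≫ s) y = (f.residueFieldMap y).hom.comp (resHom s (f y)) := by
  rw [resHom, resHom, strHom, strHom, ← CommRingCat.hom_comp, ← CommRingCat.hom_comp,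
    ← CommRingCat.hom_comp]
  congr 1
  rw [Category.assoc, Category.assoc, Category.assoc,
    ← evaluation_appLE f (U := ⊤) (V := ⊤) (le_pre_top _ _) y trivial trivial, Scheme.Hom.appLE_comp_appLE_assoc]

lemma resHom_base {k k' : Type u} [CommRing k] [CommRing k'] {Y : Scheme.{u}} (φ : k →+* k')
    (s : Y ⟶ Spec (.of k')) (y : Y) :
    resHom (s ≫ Spec.map (CommRingCat.ofHom φ)) y = (resHom s y).comp φ := by
  rw [resHom, resHom, strHom, strHom, RingHom.comp_assoc]
  congr 1
  rw [← CommRingCat.hom_ofHom φ, ← CommRingCat.hom_comp]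
  congr 1
  rw [CommRingCat.hom_ofHom, ← Category.assoc, Scheme.ΓSpecIso_inv_naturality, Category.assoc]
  congr 1

lemma strHom_finiteType {k : Type u} [CommRing k] {X : Scheme.{u}} (s : X ⟶ Spec (.of k))
    [LocallyOfFiniteType s] (U : X.Opens) (hU : IsAffineOpen U) : (strHom s U).FiniteType := by
  have h := s.finiteType_appLE (isAffineOpen_top _) hU (le_pre_top s U)
  rw [strHom, CommRingCat.hom_comp]
  exact h.comp (RingHom.FiniteType.of_surjective _
    (ConcreteCategory.bijective_of_isIso (Scheme.ΓSpecIso (.of k)).inv).2)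

lemma evaluation_hfrac {X : Scheme.{u}} {U : X.Opens} (hU : IsAffineOpen U) (x : X) (hx : x ∈ U) :
    HFrac (X.evaluation U x hx).hom := by
  intro z
  obtain ⟨w, rfl⟩ := X.residue_surjective x z
  let x' : U := ⟨x, hx⟩
  letI := TopCat.Presheaf.algebra_section_stalk X.presheaf x'
  haveI := hU.isLocalization_stalk x'
  obtain ⟨⟨a, b⟩, hab⟩ := IsLocalization.surj (hU.primeIdealOf x').asIdeal.primeCompl w
  have hb := IsLocalization.map_units (X.presheaf.stalk x) b
  refine ⟨a, b, ?_, ?_⟩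
  · have := hb.map (X.residue x).hom
    exact this.ne_zero
  · exact (map_mul (X.residue x).hom _ _).symm.trans (congrArg (X.residue x).hom hab)

lemma evaluation_specializes {X : Scheme.{u}} {U : X.Opens} {x x' : X} (h : x ⤳ x') (hx : x ∈ U)
    (hx' : x' ∈ U) (a : Γ(X, U)) (ha : X.evaluation U x hx a = 0) :
    X.evaluation U x' hx' a = 0 := by
  rw [Scheme.evaluation_eq_zero_iff_notMem_basicOpen] at ha ⊢
  exact fun h' => ha (h.mem_open (X.basicOpen a).isOpen h')

noncomputable def dlt {k : Type u} [CommRing k] {X : Scheme.{u}} (s : X ⟶ Spec (.of k))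
    (x : X) : ℕ := (trd (resHom s x)).toNat

lemma trd_resHom_lt_aleph0 {k : Type u} [Field k] {X : Scheme.{u}} (s : X ⟶ Spec (.of k))
    [LocallyOfFiniteType s] (x : X) : trd (resHom s x) < Cardinal.aleph0 := by
  obtain ⟨U, hU, hx, -⟩ := exists_isAffineOpen_mem_and_subset (U := ⊤) (x := x) trivial
  rw [resHom_eq s U x hx]
  exact trd_fin _ (strHom_finiteType s U hU) _ (evaluation_hfrac hU x hx)

lemma dlt_strict {k : Type u} [Field k] {X : Scheme.{u}} (s : X ⟶ Spec (.of k))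
    [LocallyOfFiniteType s] (x x' : X) (h : x ⤳ x') (h' : ¬ x' ⤳ x) : dlt s x' < dlt s x := by
  obtain ⟨U, hU, hx', -⟩ := exists_isAffineOpen_mem_and_subset (U := ⊤) (x := x') trivial
  have hx : x ∈ U := h.mem_open U.isOpen hx'
  rw [specializes_iff_forall_open] at h'
  push Not at h'
  obtain ⟨W, hW, hxW, hx'W⟩ := h'
  obtain ⟨f, hf, hxf⟩ := hU.exists_basicOpen_le (V := ⟨W, hW⟩) ⟨x, hxW⟩ hx
  refine Cardinal.toNat_lt_toNat ?_ (trd_resHom_lt_aleph0 s x)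
  have hfin := trd_resHom_lt_aleph0 s x
  rw [resHom_eq s U x hx] at hfin ⊢
  rw [resHom_eq s U x' hx']
  refine trd_lt _ _ _ (evaluation_hfrac hU x' hx') ?_ f ?_ ?_ hfin
  · exact fun a => evaluation_specializes h hx hx' a
  · exact (X.evaluation_eq_zero_iff_notMem_basicOpen x' hx' f).2 fun h'' => hx'W (hf h'')
  · exact (X.evaluation_ne_zero_iff_mem_basicOpen x hx f).2 hxf

lemma dlt_le_dim {k : Type u} [Field k] {X : Scheme.{u}} (s : X ⟶ Spec (.of k))
    [LocallyOfFiniteType s] (x : X) :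
    (((dlt s x : ℕ) : ℕ∞) : WithBot ℕ∞) ≤ topologicalKrullDim X := by
  obtain ⟨U, hU, hx, -⟩ := exists_isAffineOpen_mem_and_subset (U := ⊤) (x := x) trivial
  have h1 := trd_le_dim _ (strHom_finiteType s U hU) _ (evaluation_hfrac hU x hx)
  rw [← resHom_eq] at h1
  refine h1.trans ?_
  rw [← PrimeSpectrum.topologicalKrullDim_eq_ringKrullDim]
  exact hU.fromSpec.isOpenEmbedding.isInducing.topologicalKrullDim_le

lemma dim_le_dlt {k : Type u} [Field k] {X : Scheme.{u}} (s : X ⟶ Spec (.of k))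
    [LocallyOfFiniteType s] (η : X) (hη : ∀ x, η ⤳ x) :
    topologicalKrullDim X ≤ (((dlt s η : ℕ) : ℕ∞) : WithBot ℕ∞) := by
  choose g hg using fun Z : IrreducibleCloseds X => QuasiSober.sober Z.isIrreducible Z.isClosed
  have hmono : StrictMono (fun Z => dlt s (g Z)) := by
    intro Z Z' h
    apply dlt_strict s
    · exact (hg Z').specializes (h.le (hg Z).mem)
    · intro h'
      refine absurd h.le (not_le_of_gt ?_)
      refine absurd ?_ h.not_ge
      intro z hz
      have h3 := (hg Z').specializes hz
      exact Z.isClosed.stableUnderSpecialization (h'.trans h3) (hg Z).mem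
  refine iSup_le fun l => ?_
  have h1 := (l.map _ hmono).head_add_length_le_nat
  have h2 : dlt s (g (RelSeries.last l)) ≤ dlt s η := by
    by_cases h : g (RelSeries.last l) ⤳ η
    · rw [(h.antisymm (hη _)).eq]
    · exact (dlt_strict s _ _ (hη _) h).le
  have h3 : (l.map _ hmono).last = dlt s (g (RelSeries.last l)) := rfl
  have h4 : (l.map _ hmono).length = l.length := rfl
  rw [h3, h4] at h1
  have : l.length ≤ dlt s η := by omega
  exact_mod_cast this

lemma trd_tower {k k' : Type u} [Field k] [Field k'] (φ : k →+* k') (hφ : φ.IsIntegral)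
    {X Y : Scheme.{u}} (s : X ⟶ Spec (.of k)) (t : Y ⟶ Spec (.of k')) (f : Y ⟶ X)
    (h : f ≫ s = t ≫ Spec.map (CommRingCat.ofHom φ)) (y : Y) :
    trd (resHom s (f y)) + trd (f.residueFieldMap y).hom = trd (resHom t y) := by
  have h1 := resHom_comp s f y
  rw [h, resHom_base] at h1
  have h2 := congrArg trd h1
  rw [trd_comp, trd_comp, (trd_eq_zero_iff φ).2 hφ, zero_add] at h2
  exact h2.symm

lemma dlt_tower {k k' : Type u} [Field k] [Field k'] (φ : k →+* k') (hφ : φ.IsIntegral)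
    {X Y : Scheme.{u}} (s : X ⟶ Spec (.of k)) (t : Y ⟶ Spec (.of k')) (f : Y ⟶ X)
    [LocallyOfFiniteType t]
    (h : f ≫ s = t ≫ Spec.map (CommRingCat.ofHom φ)) (y : Y) :
    dlt s (f y) ≤ dlt t y ∧ (dlt t y ≤ dlt s (f y) ↔ (f.residueFieldMap y).hom.IsIntegral) := by
  have h1 := trd_tower φ hφ s t f h y
  have h2 := trd_resHom_lt_aleph0 t y
  rw [← h1] at h2
  have h3 := lt_of_le_of_lt le_self_add h2
  have h4 := lt_of_le_of_lt le_add_self h2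
  have h5 : dlt t y = dlt s (f y) + (trd (f.residueFieldMap y).hom).toNat := by
    rw [dlt, dlt, ← h1, Cardinal.toNat_add h3 h4]
  refine ⟨by omega, ?_⟩
  rw [← trd_eq_zero_iff, h5]
  constructor
  · intro h
    have h6 : (trd (f.residueFieldMap y).hom).toNat = 0 := by omega
    rcases Cardinal.toNat_eq_zero.1 h6 with h7 | h7
    · exact h7
    · exact absurd h4 (not_lt_of_ge h7)
  · intro h
    rw [h]; simp

lemma residueFieldMap_isIntegral {X Y : Scheme.{u}} (f : Y ⟶ X) [IsIntegralHom f] (y : Y) :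
    (f.residueFieldMap y).hom.IsIntegral := by
  obtain ⟨U, hU, hx, -⟩ := exists_isAffineOpen_mem_and_subset (U := ⊤) (x := f y) trivial
  have hV : IsAffineOpen (f ⁻¹ᵁ U) := hU.preimage f
  have hintg := f.isIntegral_app U hU
  have h1 : ∀ b : Γ(Y, f ⁻¹ᵁ U), (f.residueFieldMap y).hom.IsIntegralElem
      (Y.evaluation (f ⁻¹ᵁ U) y hx b) := by
    intro b
    obtain ⟨p, hp, hp0⟩ := hintg b
    refine ⟨p.map (X.evaluation U (f y) hx).hom, hp.map _, ?_⟩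
    have := congrArg CommRingCat.Hom.hom (Scheme.evaluation_naturality f y hx)
    rw [CommRingCat.hom_comp, CommRingCat.hom_comp] at this
    rw [Polynomial.eval₂_map, this]
    change Polynomial.eval₂ _ ((Y.evaluation (f ⁻¹ᵁ U) y hx).hom b) p = 0
    rw [← Polynomial.hom_eval₂, hp0, map_zero]
  letI := (f.residueFieldMap y).hom.toAlgebra
  intro z
  obtain ⟨a, b, hb, hab⟩ := evaluation_hfrac hV y hx z
  have : z = (Y.evaluation (f ⁻¹ᵁ U) y hx).hom a * ((Y.evaluation (f ⁻¹ᵁ U) y hx).hom b)⁻¹ := by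
    rw [← hab]; field_simp
  change IsIntegral (X.residueField (f y)) z
  rw [this]
  exact IsIntegral.mul (h1 a) (IsIntegral.inv (h1 b))

lemma exists_alg_locus {F : Type u} [Field F] {X C : Scheme.{u}} (sC : C ⟶ Spec (.of F))
    [LocallyOfFiniteType sC] (b : C ⟶ X) (ηC : C) (hηC : ∀ y, ηC ⤳ y)
    (hF : ∀ y (z : F), (b.residueFieldMap y).hom.IsIntegralElem (resHom sC y z))
    (hintg : (b.residueFieldMap ηC).hom.IsIntegral) (y : C) :
    ∃ (V : C.Opens) (D : X.Opens), y ∈ V ∧ b ηC ∈ D ∧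
      ∀ y' ∈ V, b y' ∈ D → (b.residueFieldMap y').hom.IsIntegral := by
  obtain ⟨U, hU, hyU, -⟩ := exists_isAffineOpen_mem_and_subset (U := ⊤) (x := b y) trivial
  obtain ⟨V, hV, hyV, hVU⟩ := exists_isAffineOpen_mem_and_subset (U := b ⁻¹ᵁ U) (x := y) hyU
  have hVU' : V ≤ b ⁻¹ᵁ U := hVU
  have hηV : ηC ∈ V := (hηC y).mem_open V.isOpen hyV
  have hηU : b ηC ∈ U := hVU hηV
  have hcomm : ∀ (y' : C) (h1 : y' ∈ V) (h2 : b y' ∈ U),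
      (b.residueFieldMap y').hom.comp (X.evaluation U (b y') h2).hom =
      (C.evaluation V y' h1).hom.comp (b.appLE U V hVU').hom := by
    intro y' h1 h2
    have := congrArg CommRingCat.Hom.hom (evaluation_appLE b hVU' y' h1 h2)
    rw [CommRingCat.hom_comp, CommRingCat.hom_comp] at this
    exact this.symm
  choose q hq hq0 using alg_poly (X.evaluation U (b ηC) hηU).hom (evaluation_hfrac hU _ hηU)
    (b.appLE U V hVU').hom (C.evaluation V ηC hηV).hom (b.residueFieldMap ηC).hom
    (hcomm _ _ _) hintg
  have hft := strHom_finiteType sC V hV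
  obtain ⟨s, hs⟩ : letI := (strHom sC V).toAlgebra
    ∃ s : Finset Γ(C, V), Algebra.adjoin F (s : Set Γ(C, V)) = ⊤ := by
    letI := (strHom sC V).toAlgebra
    haveI : Algebra.FiniteType F Γ(C, V) := hft
    exact this.out
  refine ⟨V, X.basicOpen (∏ t ∈ s, (q t).leadingCoeff), hyV, ?_, ?_⟩
  · rw [← X.evaluation_ne_zero_iff_mem_basicOpen _ hηU]
    change (X.evaluation U (b ηC) hηU).hom _ ≠ 0
    rw [map_prod, Finset.prod_ne_zero_iff]
    exact fun t _ => hq t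
  · intro y' hy' hD
    have hyU' : b y' ∈ U := hVU hy'
    rw [← X.evaluation_ne_zero_iff_mem_basicOpen _ hyU'] at hD
    change (X.evaluation U (b y') hyU').hom _ ≠ 0 at hD
    rw [map_prod, Finset.prod_ne_zero_iff] at hD
    refine isIntegral_of_gen (strHom sC V) s hs (C.evaluation V y' hy').hom
      (evaluation_hfrac hV y' hy') _ ?_ ?_
    · intro z
      have := hF y' z
      rw [resHom_eq sC V y' hy'] at this
      exact this
    · intro t ht
      letI := (b.residueFieldMap y').hom.toAlgebra
      refine IsAlgebraic.isIntegral (K := X.residueField (b y'))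
        ⟨(q t).map (X.evaluation U (b y') hyU').hom, ?_, ?_⟩
      · intro h0
        apply hD t ht
        have := congrArg (fun p => p.coeff (q t).natDegree) h0
        simpa [Polynomial.coeff_map] using this
      · rw [Polynomial.aeval_def, Polynomial.eval₂_map]
        change Polynomial.eval₂ ((b.residueFieldMap y').hom.comp _) _ _ = 0
        rw [hcomm y' hy' hyU', ← Polynomial.hom_eval₂]
        exact evaluation_specializes (hηC y') hηV hy' _ (hq0 t)

lemma exists_N {F : Type u} [Field F] {X C : Scheme.{u}} (sC : C ⟶ Spec (.of F))
    [LocallyOfFiniteType sC] [CompactSpace C] (b : C ⟶ X) (ηC : C) (hηC : ∀ y, ηC ⤳ y)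
    (hF : ∀ y (z : F), (b.residueFieldMap y).hom.IsIntegralElem (resHom sC y z))
    (hintg : (b.residueFieldMap ηC).hom.IsIntegral) :
    ∃ N : Set X, IsClosed N ∧ b ηC ∉ N ∧
      ∀ y, b y ∉ N → (b.residueFieldMap y).hom.IsIntegral := by
  choose V D hyV hD h using exists_alg_locus sC b ηC hηC hF hintg
  obtain ⟨t, ht⟩ := isCompact_univ.elim_finite_subcover (fun y => (V y : Set C))
    (fun y => (V y).isOpen) (fun y _ => Set.mem_iUnion.2 ⟨y, hyV y⟩)
  refine ⟨⋃ y ∈ t, (D y : Set X)ᶜ, ?_, ?_, ?_⟩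
  · exact t.finite_toSet.isClosed_biUnion fun y _ => (D y).isOpen.isClosed_compl
  · simp only [Set.mem_iUnion, not_exists]
    exact fun y _ h' => h' (hD y)
  · intro y hy
    obtain ⟨i, hi, hyi⟩ := Set.mem_iUnion₂.1 (ht (Set.mem_univ y))
    refine h i y hyi ?_
    by_contra hc
    exact hy (Set.mem_iUnion₂.2 ⟨i, hi, hc⟩)

lemma noeth_of_ft {k : Type u} [Field k] {X : Scheme.{u}} (s : X ⟶ Spec (.of k))
    [LocallyOfFiniteType s] [QuasiCompact s] : IsNoetherian X := by
  haveI : IsLocallyNoetherian X := LocallyOfFiniteType.isLocallyNoetherian s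
  haveI : CompactSpace X := QuasiCompact.compactSpace_of_compactSpace s
  exact {}

lemma key_X0 {k k' : Type u} [Field k] [Field k'] (φ : k →+* k') (hφ : φ.IsIntegral)
    {X C : Scheme.{u}} (s : X ⟶ Spec (.of k)) [LocallyOfFiniteType s] [QuasiCompact s]
    (sC : C ⟶ Spec (.of k')) [LocallyOfFiniteType sC] [QuasiCompact sC] (a b : C ⟶ X)
    (ha : a ≫ s = sC ≫ Spec.map (CommRingCat.ofHom φ))
    (hb : b ≫ s = sC ≫ Spec.map (CommRingCat.ofHom φ))
    (η : X) (hη : ∀ x, η ⤳ x) (ηC : C) (hηC : ∀ y, ηC ⤳ y) (hbη : b ηC = η)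
    (hd : dlt sC ηC ≤ dlt s η) (X00 : Set X) (hX00 : IsOpen X00) (hηX : η ∈ X00) :
    ∃ (V : X.Opens) (Y : Scheme.{u}) (π : Y ⟶ X), η ∈ V ∧ (V : Set X) ⊆ X00 ∧ IsProper π ∧
      IsIso (π ∣_ V) ∧ ∀ y : Y, ∃ U : Set Y, IsOpen U ∧ y ∈ U ∧
        ∀ (z : C), ∀ y1 ∈ U, ∀ y2 ∈ U, π y1 = a z → π y2 = b z → π y2 ∉ V → π y1 ∉ V := by
  haveI : IsNoetherian X := noeth_of_ft s
  haveI : IsNoetherian C := noeth_of_ft sC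
  have hFint : ∀ y (z : k'), (b.residueFieldMap y).hom.IsIntegralElem (resHom sC y z) := by
    intro y z
    have h1 := resHom_comp s b y
    rw [hb, resHom_base] at h1
    obtain ⟨p, hp, hp0⟩ := hφ z
    refine ⟨p.map (resHom s (b y)), hp.map _, ?_⟩
    rw [Polynomial.eval₂_map, ← h1, ← Polynomial.hom_eval₂, hp0, map_zero]
  subst hbη
  have hintg : (b.residueFieldMap ηC).hom.IsIntegral := (dlt_tower φ hφ s sC b hb ηC).2.1 hd
  obtain ⟨N, hN, hηN, hNi⟩ := exists_N sC b ηC hηC hFint hintg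
  -- finite affine cover
  choose W hW hxW _ using fun x : X =>
    exists_isAffineOpen_mem_and_subset (U := ⊤) (x := x) trivial
  obtain ⟨t, ht⟩ := isCompact_univ.elim_finite_subcover (fun x => (W x : Set X))
    (fun x => (W x).isOpen) (fun x _ => Set.mem_iUnion.2 ⟨x, hxW x⟩)
  obtain ⟨Z', P', hZ', hZ1, hηZ', hP', hPZ, hsep⟩ := topo_main a b a.continuous b.continuous
    (dlt s) (dlt sC) (fun y => (dlt_tower φ hφ s sC a ha y).1) N hN
    (fun y hy => (dlt_tower φ hφ s sC b hb y).2.2 (hNi y hy)) (dlt_strict s) (b ηC) hη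
    (by
      intro y hy
      refine lt_of_lt_of_le (dlt_strict sC ηC y (hηC y) ?_) hd
      intro h
      have : y = ηC := (h.antisymm (hηC y)).eq
      exact hηN (this ▸ hy)) hηN (X00ᶜ ∪ ⋃ x ∈ t, (W x : Set X)ᶜ)
    (hX00.isClosed_compl.union (t.finite_toSet.isClosed_biUnion
      fun x _ => (W x).isOpen.isClosed_compl))
    (by
      rintro (h | h)
      · exact h hηX
      · obtain ⟨x, hx, h⟩ := Set.mem_iUnion₂.1 h
        exact h ((hη x).mem_open (W x).isOpen (hxW x)))
  let V : X.Opens := ⟨Z'ᶜ, hZ'.isOpen_compl⟩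
  obtain ⟨Y, π, hπ, hiso, hloc⟩ := geo_main V (W '' t) (t.finite_toSet.image W) (by
      rintro _ ⟨x, hx, rfl⟩
      refine ⟨hW x, fun v hv => ?_⟩
      by_contra hc
      exact hv (hZ1 (Or.inr (Set.mem_iUnion₂.2 ⟨x, hx, hc⟩)))) (by
      intro x
      obtain ⟨i, hi, hxi⟩ := Set.mem_iUnion₂.1 (ht (Set.mem_univ x))
      exact ⟨W i, ⟨i, hi, rfl⟩, hxi⟩) P' hP' (fun p hp h => h (hPZ p hp))
  refine ⟨V, Y, π, hηZ', ?_, hπ, hiso, ?_⟩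
  · intro v hv
    by_contra hc
    exact hv (hZ1 (Or.inl hc))
  · intro y
    obtain ⟨U, hU, hyU, h⟩ := hloc y
    refine ⟨U, hU, hyU, fun z y1 hy1 y2 hy2 e1 e2 hn hn' => ?_⟩
    obtain ⟨p, hp, hp1, hp2, hp3⟩ := hsep z (by
      rw [← e2]; by_contra hc; exact hn hc) (by rw [← e1]; exact hn')
    rw [← e1] at hp1
    rw [← e2] at hp2 hp3
    exact hp3 (h y1 hy1 y2 hy2 hn' p hp hp1 hp2)

lemma unique_to_Spec {p : ℕ} {Y : Scheme.{u}} (f g : Y ⟶ Spec (.of (ULift.{u} (ZMod p)))) :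
    f = g := by
  apply ext_of_isAffine
  rw [← cancel_epi (Scheme.ΓSpecIso (.of (ULift.{u} (ZMod p)))).inv]
  ext x
  exact congrArg (fun r : ZMod p →+* Γ(Y, ⊤) => r x.down) (Subsingleton.elim
    ((((Scheme.ΓSpecIso (.of (ULift.{u} (ZMod p)))).inv ≫ f.appTop).hom).comp
      ULift.ringEquiv.symm.toRingHom)
    ((((Scheme.ΓSpecIso (.of (ULift.{u} (ZMod p)))).inv ≫ g.appTop).hom).comp
      ULift.ringEquiv.symm.toRingHom))

lemma baseChangeHom_fst {Xt₀ X₀ S T : Scheme.{u}} (sX₀ : X₀ ⟶ S) (g : T ⟶ S)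
    (π₀ : Xt₀ ⟶ X₀) : baseChangeHom sX₀ g π₀ ≫ pullback.fst sX₀ g =
      pullback.fst (π₀ ≫ sX₀) g ≫ π₀ :=
  pullback.lift_fst _ _ _

lemma baseChangeHom_isPullback {Xt₀ X₀ S T : Scheme.{u}} (sX₀ : X₀ ⟶ S) (g : T ⟶ S)
    (π₀ : Xt₀ ⟶ X₀) : IsPullback (pullback.fst (π₀ ≫ sX₀) g) (baseChangeHom sX₀ g π₀) π₀
      (pullback.fst sX₀ g) := by
  refine IsPullback.of_bot (v₂₁ := pullback.snd sX₀ g) (v₂₂ := sX₀) (h₃₁ := g) ?_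
    (baseChangeHom_fst sX₀ g π₀).symm (IsPullback.of_hasPullback sX₀ g)
  have : baseChangeHom sX₀ g π₀ ≫ pullback.snd sX₀ g = pullback.snd (π₀ ≫ sX₀) g :=
    (pullback.lift_snd _ _ _).trans (Category.comp_id _)
  rw [this]
  exact IsPullback.of_hasPullback _ _

/-- **Corollary 2.4.**  Let `F` be an algebraic closure of `𝔽_q`, let
`c = (c₁, c₂) : C ⟶ X ×_F X` be a correspondence between schemes of finite type over `F`
and `X⁰ ⊆ X` a non-empty open subset, such that `X` and `C` are irreducible, `c₂` is
dominant, `dim C = dim X`, and both `X` and `X⁰` are defined over `𝔽_q` (so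
`X = X₀ ×_{Spec 𝔽_q} Spec F` and `X⁰` is the preimage of an open subset `X⁰₀ ⊆ X₀`).  Then
there exist a non-empty open subset `V ⊆ X⁰` and a proper morphism `π : X̃ ⟶ X` restricting
to an isomorphism `π⁻¹(V) ≅ V`, with `V` and `π` defined over `𝔽_q`, such that for every
correspondence `c̃ : C̃ ⟶ X̃ ×_F X̃` lifting `c` along `π`, the closed subset
`X̃ ∖ π⁻¹(V) ⊆ X̃` is locally `c̃`-invariant over `𝔽_q`. -/
theorem exists_blowup_locally_invariant_over_Fq
    {Fq F : Type u} [Field Fq] [Fintype Fq] [Field F] [Algebra Fq F] [IsAlgClosure Fq F]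
    -- the `𝔽_q`-model `X₀`, of finite type over `𝔽_q`:
    (X₀ : Scheme.{u}) (sX₀ : X₀ ⟶ Spec (CommRingCat.of Fq))
    [LocallyOfFiniteType sX₀] [QuasiCompact sX₀]
    -- `X := X₀ ×_{Spec 𝔽_q} Spec F` is of finite type over `F` and irreducible:
    [LocallyOfFiniteType (pullback.snd sX₀ (specOfAlgebra Fq F))]
    [QuasiCompact (pullback.snd sX₀ (specOfAlgebra Fq F))]
    (hXirr : IrreducibleSpace (pullback sX₀ (specOfAlgebra Fq F) : Scheme.{u}))
    -- `X⁰ ⊆ X` is a non-empty open subset defined over `𝔽_q`: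
    (X00 : Set X₀) (hX00open : IsOpen X00)
    (hX0ne : ((pullback.fst sX₀ (specOfAlgebra Fq F)).base ⁻¹' X00).Nonempty)
    -- `C` is irreducible and of finite type over `F`:
    (C : Scheme.{u}) (sC : C ⟶ Spec (CommRingCat.of F))
    [LocallyOfFiniteType sC] [QuasiCompact sC] (hCirr : IrreducibleSpace C)
    -- the correspondence `c : C ⟶ X ×_F X`:
    (c : C ⟶ pullback (pullback.snd sX₀ (specOfAlgebra Fq F))
        (pullback.snd sX₀ (specOfAlgebra Fq F)))
    -- `c₂` is dominant:
    (hdom : DenseRange (c ≫ pullback.snd (pullback.snd sX₀ (specOfAlgebra Fq F))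
        (pullback.snd sX₀ (specOfAlgebra Fq F))).base)
    -- `dim C = dim X`:
    (hdim : topologicalKrullDim C =
      topologicalKrullDim ↥(pullback sX₀ (specOfAlgebra Fq F) : Scheme.{u})) :
    -- conclusion: `V₀ ⊆ X₀` and `π₀ : X̃₀ ⟶ X₀` are the `𝔽_q`-models of `V` and `π`
    ∃ (V₀ : X₀.Opens) (Xt₀ : Scheme.{u}) (π₀ : Xt₀ ⟶ X₀),
      -- `V := pr⁻¹(V₀) ⊆ X⁰` is non-empty and open (and defined over `𝔽_q`):
      ((pullback.fst sX₀ (specOfAlgebra Fq F) ⁻¹ᵁ V₀ :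
          Set ↥(pullback sX₀ (specOfAlgebra Fq F) : Scheme.{u}))).Nonempty ∧
      (pullback.fst sX₀ (specOfAlgebra Fq F) ⁻¹ᵁ V₀ :
          Set ↥(pullback sX₀ (specOfAlgebra Fq F) : Scheme.{u})) ⊆
        (pullback.fst sX₀ (specOfAlgebra Fq F)).base ⁻¹' X00 ∧
      -- `π : X̃ ⟶ X`, the base change of `π₀`, is proper:
      IsProper (baseChangeHom sX₀ (specOfAlgebra Fq F) π₀) ∧
      -- `π` restricts to an isomorphism `π⁻¹(V) ≅ V`:
      IsIso (baseChangeHom sX₀ (specOfAlgebra Fq F) π₀ ∣_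
        (pullback.fst sX₀ (specOfAlgebra Fq F) ⁻¹ᵁ V₀)) ∧
      -- for every correspondence `c̃ : C̃ ⟶ X̃ ×_F X̃` lifting `c` along `π`,
      -- `X̃ ∖ π⁻¹(V)` is locally `c̃`-invariant over `𝔽_q`:
      ∀ (Ct : Scheme.{u}) (sCt : Ct ⟶ Spec (CommRingCat.of F)),
        LocallyOfFiniteType sCt → QuasiCompact sCt →
        ∀ ct : Ct ⟶ pullback (pullback.snd (π₀ ≫ sX₀) (specOfAlgebra Fq F))
            (pullback.snd (π₀ ≫ sX₀) (specOfAlgebra Fq F)),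
          (∃ πC : Ct ⟶ C,
            πC ≫ c ≫ pullback.fst (pullback.snd sX₀ (specOfAlgebra Fq F))
                (pullback.snd sX₀ (specOfAlgebra Fq F)) =
              ct ≫ pullback.fst (pullback.snd (π₀ ≫ sX₀) (specOfAlgebra Fq F))
                  (pullback.snd (π₀ ≫ sX₀) (specOfAlgebra Fq F)) ≫
                baseChangeHom sX₀ (specOfAlgebra Fq F) π₀ ∧
            πC ≫ c ≫ pullback.snd (pullback.snd sX₀ (specOfAlgebra Fq F))
                (pullback.snd sX₀ (specOfAlgebra Fq F)) =
              ct ≫ pullback.snd (pullback.snd (π₀ ≫ sX₀) (specOfAlgebra Fq F))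
                  (pullback.snd (π₀ ≫ sX₀) (specOfAlgebra Fq F)) ≫
                baseChangeHom sX₀ (specOfAlgebra Fq F) π₀) →
          CorrLocallyInvariantOver (pullback.fst (π₀ ≫ sX₀) (specOfAlgebra Fq F))
            (ct ≫ pullback.fst (pullback.snd (π₀ ≫ sX₀) (specOfAlgebra Fq F))
              (pullback.snd (π₀ ≫ sX₀) (specOfAlgebra Fq F)))
            (ct ≫ pullback.snd (pullback.snd (π₀ ≫ sX₀) (specOfAlgebra Fq F))
              (pullback.snd (π₀ ≫ sX₀) (specOfAlgebra Fq F)))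
            (Set.univ \ (baseChangeHom sX₀ (specOfAlgebra Fq F) π₀).base ⁻¹'
              (pullback.fst sX₀ (specOfAlgebra Fq F) ⁻¹ᵁ V₀ :
                Set ↥(pullback sX₀ (specOfAlgebra Fq F) : Scheme.{u}))) := by
  obtain ⟨p, hp⟩ := CharP.exists Fq
  haveI hpp : Fact p.Prime := ⟨CharP.char_is_prime Fq p⟩
  let ψ : ULift.{u} (ZMod p) →+* Fq := (ZMod.castHom dvd_rfl Fq).comp ULift.ringEquiv.toRingHom
  have hψ : ψ.Finite := by
    letI := ψ.toAlgebra
    change Module.Finite _ _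
    infer_instance
  have hψF : ((algebraMap Fq F).comp ψ).IsIntegral := by
    refine RingHom.IsIntegral.trans _ _ hψ.to_isIntegral ?_
    haveI := IsAlgClosure.isAlgebraic (R := Fq) (K := F)
    exact algebraMap_isIntegral_iff.2 inferInstance
  haveI hL : LocallyOfFiniteType (Spec.map (CommRingCat.ofHom ψ)) :=
    (HasRingHomProperty.Spec_iff (P := @LocallyOfFiniteType)).2 hψ.finiteType
  haveI : IsIntegralHom (specOfAlgebra Fq F) := (IsIntegralHom.SpecMap_iff).2 (by
    haveI := IsAlgClosure.isAlgebraic (R := Fq) (K := F)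
    exact algebraMap_isIntegral_iff.2 inferInstance)
  haveI : Surjective (specOfAlgebra Fq F) := ⟨fun x => ⟨default, Subsingleton.elim _ _⟩⟩
  have hsurj : Function.Surjective (pullback.fst sX₀ (specOfAlgebra Fq F)) := (pullback.fst sX₀ (specOfAlgebra Fq F)).surjective
  let s' := sX₀ ≫ Spec.map (CommRingCat.ofHom ψ)
  obtain ⟨ηX, hηX⟩ : ∃ η : ↥(pullback sX₀ (specOfAlgebra Fq F)), ∀ x, η ⤳ x :=
    ⟨genericPoint _, fun x => genericPoint_specializes x⟩
  obtain ⟨ηC, hηC⟩ : ∃ η : C, ∀ x, η ⤳ x :=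
    ⟨genericPoint _, fun x => genericPoint_specializes x⟩
  have hη : ∀ x, (pullback.fst sX₀ (specOfAlgebra Fq F)) ηX ⤳ x := by
    intro x
    obtain ⟨x, rfl⟩ := hsurj x
    exact (hηX x).map (pullback.fst sX₀ (specOfAlgebra Fq F)).continuous
  have hc2 : (c ≫ pullback.snd (pullback.snd sX₀ (specOfAlgebra Fq F)) (pullback.snd sX₀ (specOfAlgebra Fq F))) ηC = ηX := by
    refine (Specializes.antisymm ?_ (hηX _)).eq
    rw [specializes_iff_forall_open]
    intro U hU hm
    obtain ⟨z, hz⟩ := hdom.exists_mem_open hU ⟨_, hm⟩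
    exact ((hηC z).map (Scheme.Hom.continuous _)).mem_open hU hz
  have hd : dlt sC ηC ≤ dlt s' ((pullback.fst sX₀ (specOfAlgebra Fq F)) ηX) := by
    have h1 := (dlt_le_dim sC ηC).trans (hdim.le.trans (dim_le_dlt (pullback.snd sX₀ (specOfAlgebra Fq F)) ηX hηX))
    have h2 : dlt sC ηC ≤ dlt (pullback.snd sX₀ (specOfAlgebra Fq F)) ηX := by exact_mod_cast h1
    refine h2.trans ((dlt_tower _ hψF s' (pullback.snd sX₀ (specOfAlgebra Fq F)) (pullback.fst sX₀ (specOfAlgebra Fq F))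
      (unique_to_Spec _ _) ηX).2.2 (residueFieldMap_isIntegral _ _))
  obtain ⟨V₀, Xt₀, π₀, hηV, hVX, hprop, hiso, hloc⟩ := key_X0 _ hψF s' sC
    ((c ≫ pullback.fst (pullback.snd sX₀ (specOfAlgebra Fq F)) (pullback.snd sX₀ (specOfAlgebra Fq F))) ≫ pullback.fst sX₀ (specOfAlgebra Fq F))
    ((c ≫ pullback.snd (pullback.snd sX₀ (specOfAlgebra Fq F)) (pullback.snd sX₀ (specOfAlgebra Fq F))) ≫ pullback.fst sX₀ (specOfAlgebra Fq F))
    (unique_to_Spec _ _) (unique_to_Spec _ _) _ hη ηC hηC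
    (by rw [Scheme.Hom.comp_apply, hc2]) hd X00 hX00open (by
      obtain ⟨x, hx⟩ := hX0ne
      exact (hη _).mem_open hX00open hx)
  have hpb := baseChangeHom_isPullback sX₀ (specOfAlgebra Fq F) π₀
  refine ⟨V₀, Xt₀, π₀, ⟨ηX, hηV⟩, fun x hx => hVX hx,
    MorphismProperty.of_isPullback hpb hprop,
    isIso_restrict_of_isPullback hpb V₀ hiso, ?_⟩
  rintro Ct sCt - - ct ⟨πC, h1, h2⟩ x hx
  obtain ⟨U, hU, hxU, h⟩ := hloc (pullback.fst (π₀ ≫ sX₀) (specOfAlgebra Fq F) x)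
  have hpt : ∀ w, π₀ (pullback.fst (π₀ ≫ sX₀) (specOfAlgebra Fq F) w) =
      pullback.fst sX₀ (specOfAlgebra Fq F) (baseChangeHom sX₀ (specOfAlgebra Fq F) π₀ w) := by
    intro w
    rw [← Scheme.Hom.comp_apply, ← Scheme.Hom.comp_apply, baseChangeHom_fst]
  refine ⟨U, hU, hxU, ?_⟩
  rintro _ ⟨w, ⟨⟨hw1, -⟩, hw2, hw3⟩, rfl⟩
  refine ⟨⟨trivial, ?_⟩, hw1⟩
  have e1 := congrArg (fun m => m w) (congrArg (fun m => m ≫ pullback.fst sX₀ (specOfAlgebra Fq F)) h1)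
  have e2 := congrArg (fun m => m w) (congrArg (fun m => m ≫ pullback.fst sX₀ (specOfAlgebra Fq F)) h2)
  simp only [Category.assoc, Scheme.Hom.comp_apply] at e1 e2
  have := h (πC w) _ hw1 _ hw3 (by
      rw [hpt]; simp only [Scheme.Hom.comp_apply]; exact e1.symm) (by
      rw [hpt]; simp only [Scheme.Hom.comp_apply]; exact e2.symm) (by
      rw [hpt]; exact fun hh => hw2.2 hh)
  rw [hpt] at this
  exact fun hh => this hh
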